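/- Let Ω ⊂ ℝ^d be a nonempty bounded domain with smooth boundary. For every even integer N ≥ 2 there is a constant C such that for every u ∈ C^∞(ℝ_+×ℝ³×Ω̄) satisfying either u|_{y∈∂Ω}=0 or ∂_ν u|_{y∈∂Ω}=0, and every (t,x): Σ_{|α|≤N} ‖∂_y^α u(t,x,·)‖_{L²(Ω)} ≤ C Σ_{|α|≤N} ‖∂_{t,x}^α u(t,x,·)‖_{L²(Ω)} + C Σ_{|α|≤N−2} ‖∂_{t,x,y}^α □u(t,x,·)‖_{L²(Ω)}. -/

import Mathlib

open MeasureTheory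

noncomputable section

/-- The partial derivative in the `i`-th coordinate direction on `ℝⁿ`. -/
def pd {n : ℕ} (i : Fin n) (u : (Fin n → ℝ) → ℝ) : (Fin n → ℝ) → ℝ :=
  fun z => fderiv ℝ u z (Pi.single i 1)

/-- Iterated application of a family of first-order operators along a list of indices. -/
def opIter {α γ : Type*} (F : α → γ → γ) : List α → γ → γ
  | [] => id
  | i :: L => fun u => F i (opIter F L u)

/-- A nonempty bounded domain `Ω ⊂ ℝ^d` with smooth boundary, described by a smooth global
defining function: `Ω = {ρ < 0}`, `∂Ω = {ρ = 0}` and `∇ρ ≠ 0` on `∂Ω` (so `∇ρ` points in the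
outward normal direction along the boundary). -/
structure SmoothDomain (d : ℕ) where
  carrier : Set (Fin d → ℝ)
  isConnected : IsConnected carrier
  isOpen : IsOpen carrier
  isBounded : Bornology.IsBounded carrier
  defFun : (Fin d → ℝ) → ℝ
  defFun_smooth : ContDiff ℝ (⊤ : ℕ∞) defFun
  carrier_eq : carrier = {y | defFun y < 0}
  frontier_eq : frontier carrier = {y | defFun y = 0}
  grad_ne : ∀ y ∈ frontier carrier, fderiv ℝ defFun y ≠ 0

/-- The normal derivative `∂_ν h` on `∂Ω` (computed against the outward normal direction
`∇ρ`; it vanishes iff the genuine normal derivative does). -/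
def SmoothDomain.nder {d : ℕ} (D : SmoothDomain d) (h : (Fin d → ℝ) → ℝ)
    (y : Fin d → ℝ) : ℝ :=
  ∑ i : Fin d, fderiv ℝ D.defFun y (Pi.single i 1) * fderiv ℝ h y (Pi.single i 1)

/-- Partial derivative in the `i`-th `(t,x)` direction of a function on `(ℝ×ℝ³) × ℝ^d`
(coordinates of the first factor: `0 = t`, `1,2,3 = x`). -/
def pdtx {d : ℕ} (i : Fin 4) (u : (Fin 4 → ℝ) → (Fin d → ℝ) → ℝ) :
    (Fin 4 → ℝ) → (Fin d → ℝ) → ℝ :=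
  fun z y => fderiv ℝ (fun z' => u z' y) z (Pi.single i 1)

/-- Partial derivative in the `j`-th `y` direction of a function on `(ℝ×ℝ³) × ℝ^d`. -/
def pdy {d : ℕ} (j : Fin d) (u : (Fin 4 → ℝ) → (Fin d → ℝ) → ℝ) :
    (Fin 4 → ℝ) → (Fin d → ℝ) → ℝ :=
  fun z y => fderiv ℝ (fun y' => u z y') y (Pi.single j 1)

/-- A partial derivative in any of the `t,x,y` directions. -/
def pdmix {d : ℕ} : Fin 4 ⊕ Fin d →
    ((Fin 4 → ℝ) → (Fin d → ℝ) → ℝ) → ((Fin 4 → ℝ) → (Fin d → ℝ) → ℝ)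
  | Sum.inl i => pdtx i
  | Sum.inr j => pdy j

/-- The d'Alembertian `□ = ∂_t² - Δ_{ℝ³} - Δ_Ω` on the waveguide `ℝ×ℝ³×ℝ^d`. -/
def wBox {d : ℕ} (u : (Fin 4 → ℝ) → (Fin d → ℝ) → ℝ) :
    (Fin 4 → ℝ) → (Fin d → ℝ) → ℝ :=
  fun z y => pdtx 0 (pdtx 0 u) z y - pdtx 1 (pdtx 1 u) z y - pdtx 2 (pdtx 2 u) z y -
    pdtx 3 (pdtx 3 u) z y - ∑ j : Fin d, pdy j (pdy j u) z y

/-- Smoothness of a function of `((t,x),y)`, jointly in all variables. -/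
def SmoothC {d : ℕ} (u : (Fin 4 → ℝ) → (Fin d → ℝ) → ℝ) : Prop :=
  ContDiff ℝ (⊤ : ℕ∞) (fun p : (Fin 4 → ℝ) × (Fin d → ℝ) => u p.1 p.2)

/-- The Dirichlet boundary condition `u|_{y ∈ ∂Ω} = 0`. -/
def DirichletBC {d : ℕ} (D : SmoothDomain d) (u : (Fin 4 → ℝ) → (Fin d → ℝ) → ℝ) : Prop :=
  ∀ z : Fin 4 → ℝ, ∀ y ∈ frontier D.carrier, u z y = 0

/-- The Neumann boundary condition `∂_ν u|_{y ∈ ∂Ω} = 0`. -/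
def NeumannBC {d : ℕ} (D : SmoothDomain d) (u : (Fin 4 → ℝ) → (Fin d → ℝ) → ℝ) : Prop :=
  ∀ z : Fin 4 → ℝ, ∀ y ∈ frontier D.carrier, D.nder (u z) y = 0

/-- The `L²(Ω)` norm of `u(t,x,·)` at fixed `(t,x)`. -/
def L2y {d : ℕ} (D : SmoothDomain d) (u : (Fin 4 → ℝ) → (Fin d → ℝ) → ℝ)
    (z : Fin 4 → ℝ) : ℝ :=
  Real.sqrt (∫ y in D.carrier, (u z y)^2)

/-! ### Sums over words -/

section Words

variable {α γ : Type*}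

/-- The sum of `p (F_{σ₁} ⋯ F_{σₙ} u)` over all words `σ` of length `n < m`. -/
def wordSum [Fintype α] (F : α → γ → γ) (p : γ → ℝ) (m : ℕ) (u : γ) : ℝ :=
  ∑ n ∈ Finset.range m, ∑ σ : Fin n → α, p (opIter F (List.ofFn σ) u)

lemma opIter_append (F : α → γ → γ) (L L' : List α) (u : γ) :
    opIter F (L ++ L') u = opIter F L (opIter F L' u) := by
  induction L with
  | nil => rfl
  | cons i L ih => simp only [List.cons_append, opIter, ih]

lemma sum_opIter_succ [Fintype α] (F : α → γ → γ) (p : γ → ℝ) (n : ℕ) (u : γ) :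
    ∑ σ : Fin (n + 1) → α, p (opIter F (List.ofFn σ) u) =
      ∑ i, ∑ σ : Fin n → α, p (opIter F (List.ofFn σ) (F i u)) := by
  rw [← (Fin.snocEquiv fun _ : Fin (n + 1) => α).sum_comp, Fintype.sum_prod_type]
  refine Finset.sum_congr rfl fun i _ => Finset.sum_congr rfl fun σ _ => ?_
  rw [List.ofFn_succ', List.concat_eq_append, opIter_append]
  simp [Fin.snocEquiv, opIter]

lemma wordSum_succ [Fintype α] (F : α → γ → γ) (p : γ → ℝ) (m : ℕ) (u : γ) :
    wordSum F p (m + 1) u = p u + ∑ i, wordSum F p m (F i u) := by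
  unfold wordSum
  rw [Finset.sum_range_succ', add_comm, Finset.sum_comm]
  congr 1
  · simp [opIter]
  · exact Finset.sum_congr rfl fun n _ => sum_opIter_succ F p n u

variable {F : α → γ → γ} {p : γ → ℝ}

lemma wordSum_nonneg [Fintype α] (hp : ∀ u, 0 ≤ p u) (m : ℕ) (u : γ) :
    0 ≤ wordSum F p m u :=
  Finset.sum_nonneg fun _ _ => Finset.sum_nonneg fun _ _ => hp _

lemma wordSum_mono [Fintype α] (hp : ∀ u, 0 ≤ p u) {m n : ℕ} (h : m ≤ n) (u : γ) :
    wordSum F p m u ≤ wordSum F p n u :=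
  Finset.sum_le_sum_of_subset_of_nonneg (Finset.range_mono h)
    fun _ _ _ => Finset.sum_nonneg fun _ _ => hp _

lemma wordSum_apply_le [Fintype α] (hp : ∀ u, 0 ≤ p u) (m : ℕ) (i : α) (u : γ) :
    wordSum F p m (F i u) ≤ wordSum F p (m + 1) u := by
  rw [wordSum_succ]
  have := Finset.single_le_sum (f := fun i => wordSum F p m (F i u))
    (fun i _ => wordSum_nonneg hp m _) (Finset.mem_univ i)
  linarith [hp u]

end Words

/-! ### The algebraic setting for the a priori estimate -/

/-- An algebra of functions with commuting partial derivatives, a positive integration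
functional, a defining function of the boundary and the ideal of functions vanishing on the
boundary, together with the divergence theorem for vector fields tangent to the boundary. -/
structure EnergySpace (A : Type*) [CommRing A] [Algebra ℝ A] (d : ℕ) where
  der : Fin d → Derivation ℝ A A
  der_comm : ∀ i j f, der i (der j f) = der j (der i f)
  integral : A →ₗ[ℝ] ℝ
  integral_nonneg : ∀ f, 0 ≤ integral (f * f)
  exists_mul_bound : ∀ a, ∃ C, 0 ≤ C ∧
    ∀ f, integral ((a * f) * (a * f)) ≤ C * integral (f * f)
  defFun : A
  boundary : Ideal A
  defFun_mem : defFun ∈ boundary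
  integral_div : ∀ X : Fin d → A, ∑ l, X l * der l defFun ∈ boundary →
    integral (∑ l, der l (X l)) = 0
  tangent_mem : ∀ X : Fin d → A, ∑ l, X l * der l defFun ∈ boundary →
    ∀ f ∈ boundary, ∑ l, X l * der l f ∈ boundary
  exists_lower_bound : ∃ C, 0 ≤ C ∧ ∀ f, integral (f * f) ≤
    C * integral ((((∑ l, der l defFun ^ 2) ^ 2 + defFun ^ 2) * f) *
      (((∑ l, der l defFun ^ 2) ^ 2 + defFun ^ 2) * f))

namespace EnergySpace

variable {A : Type*} [CommRing A] [Algebra ℝ A] {d : ℕ} (S : EnergySpace A d)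

/-- The `L²` seminorm. -/
def nrm (f : A) : ℝ := √(S.integral (f * f))

lemma nrm_nonneg (f : A) : 0 ≤ S.nrm f := Real.sqrt_nonneg _

lemma nrm_sq (f : A) : S.nrm f ^ 2 = S.integral (f * f) := Real.sq_sqrt (S.integral_nonneg f)

lemma abs_integral_mul_le (f g : A) : |S.integral (f * g)| ≤ S.nrm f * S.nrm g := by
  have h : discrim (S.integral (f * f)) (2 * S.integral (f * g)) (S.integral (g * g)) ≤ 0 := by
    refine discrim_le_zero fun t => ?_
    have h := S.integral_nonneg (t • f + g)
    have e : (t • f + g) * (t • f + g) = (t * t) • (f * f) + (2 * t) • (f * g) + g * g := by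
      simp only [Algebra.smul_def, map_mul, map_ofNat]; ring
    rw [e] at h
    simp only [map_add, map_smul, smul_eq_mul] at h
    linarith
  rw [nrm, nrm, ← Real.sqrt_mul (S.integral_nonneg f)]
  refine Real.abs_le_sqrt ?_
  unfold discrim at h
  nlinarith

lemma nrm_add_le (f g : A) : S.nrm (f + g) ≤ S.nrm f + S.nrm g := by
  refine Real.sqrt_le_iff.2 ⟨add_nonneg (S.nrm_nonneg f) (S.nrm_nonneg g), ?_⟩
  have e : (f + g) * (f + g) = f * f + (f * g + f * g) + g * g := by ring
  have h := (abs_le.1 (S.abs_integral_mul_le f g)).2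
  rw [e, map_add, map_add, map_add, ← S.nrm_sq f, ← S.nrm_sq g]
  nlinarith

lemma exists_nrm_mul_le (a : A) : ∃ C, 0 ≤ C ∧ ∀ f, S.nrm (a * f) ≤ C * S.nrm f := by
  obtain ⟨C, hC, h⟩ := S.exists_mul_bound a
  refine ⟨√C, Real.sqrt_nonneg _, fun f => ?_⟩
  rw [nrm, nrm, ← Real.sqrt_mul hC]
  exact Real.sqrt_le_sqrt (h f)

/-- The Sobolev norm of order `m`. -/
def sob (m : ℕ) (f : A) : ℝ := wordSum (fun j g => S.der j g) S.nrm (m + 1) f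

lemma sob_nonneg (m : ℕ) (f : A) : 0 ≤ S.sob m f := wordSum_nonneg S.nrm_nonneg _ _

lemma sob_mono {m n : ℕ} (h : m ≤ n) (f : A) : S.sob m f ≤ S.sob n f :=
  wordSum_mono S.nrm_nonneg (by omega) f

lemma sob_zero (f : A) : S.sob 0 f = S.nrm f := by
  simp [sob, wordSum, opIter]

lemma nrm_le_sob (m : ℕ) (f : A) : S.nrm f ≤ S.sob m f := by
  rw [← sob_zero]
  exact S.sob_mono m.zero_le f

lemma sob_succ (m : ℕ) (f : A) : S.sob (m + 1) f = S.nrm f + ∑ j, S.sob m (S.der j f) :=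
  wordSum_succ _ _ _ _

lemma sob_der_le (m : ℕ) (j : Fin d) (f : A) : S.sob m (S.der j f) ≤ S.sob (m + 1) f :=
  wordSum_apply_le (F := fun j g => S.der j g) S.nrm_nonneg _ j f

lemma sob_add_le (m : ℕ) (f g : A) : S.sob m (f + g) ≤ S.sob m f + S.sob m g := by
  induction m generalizing f g with
  | zero => simpa only [sob_zero] using S.nrm_add_le f g
  | succ m ih =>
    simp only [sob_succ, map_add]
    have := Finset.sum_le_sum fun j (_ : j ∈ Finset.univ) => ih (S.der j f) (S.der j g)
    rw [Finset.sum_add_distrib] at this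
    linarith [S.nrm_add_le f g]

lemma exists_sob_mul_le (m : ℕ) (a : A) :
    ∃ C, 0 ≤ C ∧ ∀ f, S.sob m (a * f) ≤ C * S.sob m f := by
  induction m generalizing a with
  | zero => simpa only [sob_zero] using S.exists_nrm_mul_le a
  | succ m ih =>
    obtain ⟨C, hC, h⟩ := S.exists_nrm_mul_le a
    obtain ⟨C₁, hC₁, h₁⟩ := ih a
    choose C₂ hC₂ h₂ using fun j => ih (S.der j a)
    refine ⟨C + ∑ j, (C₁ + C₂ j),
      add_nonneg hC (Finset.sum_nonneg fun j _ => add_nonneg hC₁ (hC₂ j)), fun f => ?_⟩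
    rw [sob_succ, add_mul, Finset.sum_mul]
    refine add_le_add ((h f).trans ?_) (Finset.sum_le_sum fun j _ => ?_)
    · exact mul_le_mul_of_nonneg_left (S.nrm_le_sob _ _) hC
    · rw [Derivation.leibniz, smul_eq_mul, smul_eq_mul, add_mul, mul_comm f]
      refine (S.sob_add_le _ _ _).trans (add_le_add ((h₁ _).trans ?_) ((h₂ j _).trans ?_))
      · exact mul_le_mul_of_nonneg_left (S.sob_der_le m j f) hC₁
      · exact mul_le_mul_of_nonneg_left (S.sob_mono m.le_succ f) (hC₂ j)

/-! ### Differential operators and their order -/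

/-- `L` loses at most `n` derivatives. -/
def HasOrder (n : ℕ) (L : Module.End ℝ A) : Prop :=
  ∀ m, ∃ C, 0 ≤ C ∧ ∀ f, S.sob m (L f) ≤ C * S.sob (m + n) f

variable {S}

lemma HasOrder.zero (n : ℕ) : S.HasOrder n 0 := fun m => by
  obtain ⟨C, hC, h⟩ := S.exists_sob_mul_le m 0
  refine ⟨C, hC, fun f => ?_⟩
  have := h f
  rw [zero_mul] at this
  exact this.trans (mul_le_mul_of_nonneg_left (S.sob_mono (by omega) f) hC)

lemma HasOrder.add {n : ℕ} {L L' : Module.End ℝ A} (h : S.HasOrder n L)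
    (h' : S.HasOrder n L') : S.HasOrder n (L + L') := fun m => by
  obtain ⟨C, hC, h⟩ := h m
  obtain ⟨C', hC', h'⟩ := h' m
  refine ⟨C + C', add_nonneg hC hC', fun f => ?_⟩
  rw [add_mul]
  exact (S.sob_add_le _ _ _).trans (add_le_add (h f) (h' f))

lemma HasOrder.sum {n : ℕ} {ι : Type*} {s : Finset ι} {L : ι → Module.End ℝ A}
    (h : ∀ i ∈ s, S.HasOrder n (L i)) : S.HasOrder n (∑ i ∈ s, L i) :=
  Finset.sum_induction L (S.HasOrder n) (fun _ _ => HasOrder.add) (.zero n) h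

lemma HasOrder.one : S.HasOrder 0 (1 : Module.End ℝ A) :=
  fun m => ⟨1, zero_le_one, fun f => by simp⟩

lemma HasOrder.smul {n : ℕ} {L : Module.End ℝ A} (a : A) (h : S.HasOrder n L) :
    S.HasOrder n (a • L) := fun m => by
  obtain ⟨C, hC, h⟩ := h m
  obtain ⟨C', hC', h'⟩ := S.exists_sob_mul_le m a
  refine ⟨C' * C, mul_nonneg hC' hC, fun f => (h' (L f)).trans ?_⟩
  rw [mul_assoc]
  exact mul_le_mul_of_nonneg_left (h f) hC'

lemma HasOrder.mul {n n' : ℕ} {L L' : Module.End ℝ A} (h : S.HasOrder n L)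
    (h' : S.HasOrder n' L') : S.HasOrder (n + n') (L * L') := fun m => by
  obtain ⟨C, hC, h⟩ := h m
  obtain ⟨C', hC', h'⟩ := h' (m + n)
  refine ⟨C * C', mul_nonneg hC hC', fun f => (h (L' f)).trans ?_⟩
  rw [mul_assoc, ← add_assoc]
  exact mul_le_mul_of_nonneg_left (h' f) hC

variable (S)

/-- The partial derivative as an endomorphism. -/
def D (j : Fin d) : Module.End ℝ A := (S.der j : A →ₗ[ℝ] A)

lemma D_apply (j : Fin d) (f : A) : S.D j f = S.der j f := rfl

/-- The first-order operator `∑ₗ Xₗ ∂ₗ` of a vector field `X`. -/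
def vf (X : Fin d → A) : Module.End ℝ A := ∑ l, X l • S.D l

lemma vf_apply (X : Fin d → A) (f : A) : S.vf X f = ∑ l, X l * S.der l f := by
  simp [vf, LinearMap.sum_apply, D_apply]

lemma vf_mul (X : Fin d → A) (f g : A) : S.vf X (f * g) = S.vf X f * g + f * S.vf X g := by
  simp only [vf_apply, Finset.sum_mul, Finset.mul_sum, ← Finset.sum_add_distrib,
    Derivation.leibniz, smul_eq_mul]
  exact Finset.sum_congr rfl fun l _ => by ring

lemma vf_single (j : Fin d) : S.vf (Pi.single j 1) = S.D j := by
  ext f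
  simp [vf_apply, Pi.single_apply, D_apply]

/-- The commutator of two vector fields. -/
def bracket (X Y : Fin d → A) : Fin d → A := fun l => S.vf X (Y l) - S.vf Y (X l)

lemma vf_vf_sub (X Y : Fin d → A) (f : A) :
    S.vf X (S.vf Y f) - S.vf Y (S.vf X f) = S.vf (S.bracket X Y) f := by
  have h : ∀ X Y : Fin d → A, S.vf X (S.vf Y f) =
      ∑ l, S.vf X (Y l) * S.der l f + ∑ l, ∑ m, X m * Y l * S.der m (S.der l f) := by
    intro X Y
    rw [S.vf_apply Y, map_sum, ← Finset.sum_add_distrib]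
    refine Finset.sum_congr rfl fun l _ => ?_
    rw [vf_mul, S.vf_apply X (S.der l f), Finset.mul_sum]
    congr 1
    exact Finset.sum_congr rfl fun m _ => by ring
  have e : ∑ l, ∑ m, X m * Y l * S.der m (S.der l f) =
      ∑ l, ∑ m, Y m * X l * S.der m (S.der l f) := by
    rw [Finset.sum_comm]
    exact Finset.sum_congr rfl fun l _ => Finset.sum_congr rfl fun m _ => by
      rw [S.der_comm]; ring
  rw [h X Y, h Y X, e, add_sub_add_right_eq_sub, vf_apply, ← Finset.sum_sub_distrib]
  exact Finset.sum_congr rfl fun l _ => by rw [bracket, sub_mul]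

lemma hasOrder_D (j : Fin d) : S.HasOrder 1 (S.D j) :=
  fun m => ⟨1, zero_le_one, fun f => by rw [one_mul]; exact S.sob_der_le m j f⟩

lemma hasOrder_vf (X : Fin d → A) : S.HasOrder 1 (S.vf X) :=
  .sum fun l _ => (S.hasOrder_D l).smul (X l)

/-- The composition of the operators of a list of vector fields. -/
def word (l : List (Fin d → A)) : Module.End ℝ A := (l.map S.vf).prod

lemma word_nil : S.word [] = 1 := rfl

lemma word_cons (X : Fin d → A) (l : List (Fin d → A)) :
    S.word (X :: l) = S.vf X * S.word l := by
  simp [word]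

lemma word_append (l l' : List (Fin d → A)) : S.word (l ++ l') = S.word l * S.word l' := by
  simp [word]

lemma hasOrder_word (l : List (Fin d → A)) : S.HasOrder l.length (S.word l) := by
  induction l with
  | nil => exact .one
  | cons X l ih =>
    rw [word_cons, List.length_cons, add_comm]
    exact (S.hasOrder_vf X).mul ih

/-- Reordering a word of length `n + 1` changes the operator by one of order `n`. -/
lemma hasOrder_word_sub {l l' : List (Fin d → A)} (h : l.Perm l') :
    ∀ n, l.length = n + 1 → S.HasOrder n (S.word l - S.word l') := by
  induction h with
  | nil => simp
  | @cons X l₁ l₂ h ih =>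
    intro n hn
    rw [word_cons, word_cons, ← mul_sub]
    cases n with
    | zero =>
      have : l₁ = [] := by simpa using hn
      subst this
      rw [h.nil_eq, sub_self, mul_zero]
      exact .zero 0
    | succ n =>
      rw [add_comm]
      exact (S.hasOrder_vf X).mul (ih n (by simpa using hn))
  | swap X Y l =>
    intro n hn
    have e : S.word (Y :: X :: l) - S.word (X :: Y :: l) = S.word (S.bracket Y X :: l) := by
      ext f
      simp only [word_cons, LinearMap.sub_apply, Module.End.mul_apply]
      exact S.vf_vf_sub Y X _
    rw [e]
    have : n = (S.bracket Y X :: l).length := by simpa using hn.symm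
    rw [this]
    exact S.hasOrder_word _
  | @trans l₁ l₂ l₃ h₁ h₂ ih₁ ih₂ =>
    intro n hn
    rw [← sub_add_sub_cancel _ (S.word l₂)]
    exact (ih₁ n hn).add (ih₂ n (h₁.length_eq ▸ hn))

end EnergySpace


namespace EnergySpace

variable {A : Type*} [CommRing A] [Algebra ℝ A] {d : ℕ} {S : EnergySpace A d}

lemma HasOrder.mono {n n' : ℕ} {L : Module.End ℝ A} (h : S.HasOrder n L) (hn : n ≤ n') :
    S.HasOrder n' L := fun m => by
  obtain ⟨C, hC, h⟩ := h m
  exact ⟨C, hC, fun f =>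
    (h f).trans (mul_le_mul_of_nonneg_left (S.sob_mono (by omega) f) hC)⟩

variable (S)

/-! ### Tangential vector fields and the energy form -/

/-- The vector field `X` is tangent to the boundary. -/
def Tangent (X : Fin d → A) : Prop := S.vf X S.defFun ∈ S.boundary

/-- The divergence of a vector field. -/
def div (X : Fin d → A) : A := ∑ l, S.der l (X l)

/-- The formal adjoint, up to sign, of a vector field. -/
def coadj (X : Fin d → A) : Module.End ℝ A := S.vf X + S.div X • (1 : Module.End ℝ A)

lemma coadj_apply (X : Fin d → A) (f : A) : S.coadj X f = S.vf X f + S.div X * f := by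
  simp [coadj]

lemma hasOrder_coadj (X : Fin d → A) : S.HasOrder 1 (S.coadj X) :=
  (S.hasOrder_vf X).add ((HasOrder.one.smul _).mono zero_le_one)

lemma integral_mul_vf {X : Fin d → A} (hX : S.Tangent X) (f g : A) :
    S.integral (f * S.vf X g) = -S.integral (S.coadj X f * g) := by
  have h := S.integral_div (fun l => f * g * X l) (by
    have := S.boundary.mul_mem_left (f * g) hX
    rw [vf_apply, Finset.mul_sum] at this
    simpa only [mul_assoc] using this)
  have e : ∑ l, S.der l (f * g * X l) = f * S.vf X g + S.coadj X f * g := by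
    simp only [coadj_apply, vf_apply, div, Derivation.leibniz, smul_eq_mul, Finset.sum_mul,
      Finset.mul_sum, add_mul, ← Finset.sum_add_distrib]
    exact Finset.sum_congr rfl fun l _ => by ring
  rw [e, map_add] at h
  linarith

lemma der_vf (j : Fin d) (X : Fin d → A) (f : A) :
    S.der j (S.vf X f) = S.vf X (S.der j f) + ∑ l, S.der j (X l) * S.der l f := by
  rw [vf_apply, vf_apply, map_sum, ← Finset.sum_add_distrib]
  refine Finset.sum_congr rfl fun l _ => ?_
  rw [Derivation.leibniz, S.der_comm j l, smul_eq_mul, smul_eq_mul, mul_comm (S.der l f)]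

/-- The Dirichlet form. -/
def energy (f g : A) : ℝ := ∑ j, S.integral (S.der j f * S.der j g)

/-- The `L²` norm of the gradient. -/
def gradNrm (f : A) : ℝ := ∑ j, S.nrm (S.der j f)

lemma gradNrm_nonneg (f : A) : 0 ≤ S.gradNrm f :=
  Finset.sum_nonneg fun _ _ => S.nrm_nonneg _

lemma nrm_der_le (j : Fin d) (f : A) : S.nrm (S.der j f) ≤ S.gradNrm f :=
  Finset.single_le_sum (f := fun j => S.nrm (S.der j f))
    (fun _ _ => S.nrm_nonneg _) (Finset.mem_univ j)

lemma gradNrm_sq_le (f : A) : S.gradNrm f ^ 2 ≤ d * S.energy f f := by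
  have h := sq_sum_le_card_mul_sum_sq (s := (Finset.univ : Finset (Fin d)))
    (f := fun j => S.nrm (S.der j f))
  simpa [nrm_sq, gradNrm, energy] using h

/-- Tangential derivatives falling on the right factor can be moved to the left one. -/
lemma exists_abs_integral_der_word_le {β : List (Fin d → A)} (hβ : ∀ X ∈ β, S.Tangent X) :
    ∀ (n : ℕ) (L : Module.End ℝ A), S.HasOrder n L → ∀ j, ∃ C, 0 ≤ C ∧ ∀ f w,
      |S.integral (L f * S.der j (S.word β w))| ≤
        C * S.sob (n + β.length) f * S.gradNrm w := by
  induction β with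
  | nil =>
    intro n L hL j
    obtain ⟨C, hC, h⟩ := hL 0
    refine ⟨C, hC, fun f w => (S.abs_integral_mul_le _ _).trans ?_⟩
    have h := h f
    rw [sob_zero, zero_add] at h
    exact mul_le_mul h (S.nrm_der_le j w) (S.nrm_nonneg _) (mul_nonneg hC (S.sob_nonneg _ _))
  | cons X β ih =>
    intro n L hL j
    have hX := hβ X (by simp)
    have ih := ih fun Y hY => hβ Y (by simp [hY])
    obtain ⟨C, hC, h⟩ := ih (n + 1) (S.coadj X * L)
      (by rw [add_comm]; exact (S.hasOrder_coadj X).mul hL) j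
    choose C' hC' h' using fun l => ih (n + 1) (S.der j (X l) • L)
      ((hL.smul _).mono n.le_succ) l
    refine ⟨C + ∑ l, C' l, add_nonneg hC (Finset.sum_nonneg fun l _ => hC' l),
      fun f w => ?_⟩
    have e : S.integral (L f * S.der j (S.word (X :: β) w)) =
        -S.integral ((S.coadj X * L) f * S.der j (S.word β w)) +
        ∑ l, S.integral ((S.der j (X l) • L) f * S.der l (S.word β w)) := by
      rw [word_cons, Module.End.mul_apply, der_vf, mul_add, map_add, S.integral_mul_vf hX,
        Finset.mul_sum, map_sum]
      congr 1
      refine Finset.sum_congr rfl fun l _ => congrArg _ ?_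
      rw [LinearMap.smul_apply, smul_eq_mul]
      ring
    rw [e, add_mul, add_mul, Finset.sum_mul, Finset.sum_mul]
    have hn : n + (X :: β).length = n + 1 + β.length := by simp; omega
    rw [hn]
    refine (abs_add_le _ _).trans (add_le_add ?_ ((Finset.abs_sum_le_sum_abs _ _).trans ?_))
    · rw [abs_neg]; exact h f w
    · exact Finset.sum_le_sum fun l _ => h' l f w

lemma energy_vf {X : Fin d → A} (hX : S.Tangent X) (f g : A) :
    S.energy (S.vf X f) g = -S.energy f (S.vf X g) +
      ∑ j, S.integral ((∑ l, S.der j (X l) • S.D l + (-S.div X) • S.D j) f * S.der j g) +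
      ∑ j, ∑ l, S.integral ((S.der j (X l) • S.D j) f * S.der l g) := by
  simp only [energy, ← Finset.sum_neg_distrib, ← Finset.sum_add_distrib]
  refine Finset.sum_congr rfl fun j _ => ?_
  have h := S.integral_mul_vf hX (S.der j f) (S.der j g)
  rw [coadj_apply, add_mul, map_add] at h
  have e₁ : ∑ l, S.integral ((S.der j (X l) • S.D j) f * S.der l g) =
      S.integral (S.der j f * ∑ l, S.der j (X l) * S.der l g) := by
    rw [Finset.mul_sum, map_sum]
    refine Finset.sum_congr rfl fun l _ => congrArg _ ?_
    rw [LinearMap.smul_apply, D_apply, smul_eq_mul]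
    ring
  have e₂ : (∑ l, S.der j (X l) • S.D l + (-S.div X) • S.D j) f =
      ∑ l, S.der j (X l) * S.der l f - S.div X * S.der j f := by
    simp [LinearMap.sum_apply, D_apply, sub_eq_add_neg]
  rw [e₁, e₂, der_vf, der_vf, add_mul, mul_add, sub_mul, map_add, map_add, map_sub]
  linarith

/-! ### Weak solutions and the tangential estimate -/

/-- The Laplacian. -/
def lap : Module.End ℝ A := ∑ j, S.D j * S.D j

lemma lap_apply (f : A) : S.lap f = ∑ j, S.der j (S.der j f) := by
  simp [lap, LinearMap.sum_apply, D_apply]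

/-- The elements `v` of `V` for which Green's formula against `V` has no boundary term. -/
def weak (V : Ideal A) : Set A :=
  {v | v ∈ V ∧ ∀ φ ∈ V, S.energy v φ = -S.integral (S.lap v * φ)}

/-- The right-hand side of the estimate of order `k + 2`. -/
def rhs (k : ℕ) (v : A) : ℝ := S.sob k (S.lap v) + S.sob (k + 1) v

lemma rhs_nonneg (k : ℕ) (v : A) : 0 ≤ S.rhs k v :=
  add_nonneg (S.sob_nonneg _ _) (S.sob_nonneg _ _)

/-- The ideal `V` is preserved by tangential vector fields. -/
def Invariant (V : Ideal A) : Prop := ∀ X, S.Tangent X → ∀ f ∈ V, S.vf X f ∈ V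

variable {S} in
lemma Invariant.word_mem {V : Ideal A} (hV : S.Invariant V) {β : List (Fin d → A)}
    (hβ : ∀ X ∈ β, S.Tangent X) {f : A} (hf : f ∈ V) : S.word β f ∈ V := by
  induction β with
  | nil => exact hf
  | cons X β ih =>
    rw [word_cons]
    exact hV X (hβ X (by simp)) _ (ih fun Y hY => hβ Y (by simp [hY]))

lemma exists_abs_energy_word_le {V : Ideal A} (hV : S.Invariant V) (k : ℕ)
    {α : List (Fin d → A)} (hα : ∀ X ∈ α, S.Tangent X) :
    ∀ β : List (Fin d → A), (∀ X ∈ β, S.Tangent X) → α.length + β.length = k + 1 →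
      ∃ C, 0 ≤ C ∧ ∀ v ∈ S.weak V, ∀ w ∈ V,
        |S.energy (S.word α v) (S.word β w)| ≤ C * S.rhs k v * S.gradNrm w := by
  induction α with
  | nil =>
    intro β hβ hk
    cases β with
    | nil => simp at hk
    | cons X β =>
      have hβ' : ∀ Y ∈ β, S.Tangent Y := fun Y hY => hβ Y (by simp [hY])
      have hk : β.length = k := by simpa using hk
      choose C hC h using fun l =>
        S.exists_abs_integral_der_word_le hβ' 0 (X l • (1 : Module.End ℝ A))
          (HasOrder.one.smul _) l
      refine ⟨∑ l, C l, Finset.sum_nonneg fun l _ => hC l, fun v hv w hw => ?_⟩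
      have e : S.integral (S.lap v * S.word (X :: β) w) = ∑ l, S.integral
          ((X l • (1 : Module.End ℝ A)) (S.lap v) * S.der l (S.word β w)) := by
        rw [word_cons, Module.End.mul_apply, vf_apply, Finset.mul_sum, map_sum]
        refine Finset.sum_congr rfl fun l _ => congrArg _ ?_
        rw [LinearMap.smul_apply, Module.End.one_apply, smul_eq_mul]
        ring
      rw [word_nil, Module.End.one_apply, hv.2 _ (hV.word_mem hβ hw), abs_neg, e,
        Finset.sum_mul, Finset.sum_mul]
      refine (Finset.abs_sum_le_sum_abs _ _).trans (Finset.sum_le_sum fun l _ =>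
        (h l _ _).trans ?_)
      rw [zero_add, hk]
      refine mul_le_mul_of_nonneg_right (mul_le_mul_of_nonneg_left ?_ (hC l))
        (S.gradNrm_nonneg w)
      exact le_add_of_nonneg_right (S.sob_nonneg _ _)
  | cons X α ih =>
    intro β hβ hk
    have hX := hα X (by simp)
    have hα' : ∀ Y ∈ α, S.Tangent Y := fun Y hY => hα Y (by simp [hY])
    have hk' : 1 + α.length + β.length = k + 1 := by simpa [add_comm] using hk
    obtain ⟨C, hC, h⟩ := ih hα' (X :: β) (by simpa [hX] using hβ) (by simp; omega)
    choose C₁ hC₁ h₁ using fun j => S.exists_abs_integral_der_word_le hβ (1 + α.length)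
      ((∑ l, S.der j (X l) • S.D l + (-S.div X) • S.D j) * S.word α)
      (((HasOrder.sum fun l _ => (S.hasOrder_D l).smul _).add ((S.hasOrder_D j).smul _)).mul
        (S.hasOrder_word α)) j
    choose C₂ hC₂ h₂ using fun j l => S.exists_abs_integral_der_word_le hβ (1 + α.length)
      ((S.der j (X l) • S.D j) * S.word α)
      (((S.hasOrder_D j).smul _).mul (S.hasOrder_word α)) l
    rw [hk'] at h₁ h₂
    refine ⟨C + ∑ j, C₁ j + ∑ j, ∑ l, C₂ j l, add_nonneg (add_nonneg hC
      (Finset.sum_nonneg fun j _ => hC₁ j))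
      (Finset.sum_nonneg fun j _ => Finset.sum_nonneg fun l _ => hC₂ j l),
      fun v hv w hw => ?_⟩
    have hr : ∀ c, 0 ≤ c → c * S.sob (k + 1) v * S.gradNrm w ≤
        c * S.rhs k v * S.gradNrm w := fun c hc =>
      mul_le_mul_of_nonneg_right (mul_le_mul_of_nonneg_left
        (le_add_of_nonneg_left (S.sob_nonneg _ _)) hc) (S.gradNrm_nonneg w)
    rw [word_cons, Module.End.mul_apply, S.energy_vf hX]
    simp only [add_mul, Finset.sum_mul]
    refine (abs_add_three _ _ _).trans (add_le_add (add_le_add ?_ ?_) ?_)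
    · rw [abs_neg]
      simpa only [word_cons, Module.End.mul_apply] using h v hv w hw
    · exact (Finset.abs_sum_le_sum_abs _ _).trans
        (Finset.sum_le_sum fun j _ => (h₁ j v w).trans (hr _ (hC₁ j)))
    · refine (Finset.abs_sum_le_sum_abs _ _).trans (Finset.sum_le_sum fun j _ => ?_)
      exact (Finset.abs_sum_le_sum_abs _ _).trans
        (Finset.sum_le_sum fun l _ => (h₂ j l v w).trans (hr _ (hC₂ j l)))

/-- The operators which are bounded by `rhs k` on weak solutions. -/
def controlled (V : Ideal A) (k : ℕ) : Submodule A (Module.End ℝ A) where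
  carrier := {L | ∃ C, 0 ≤ C ∧ ∀ v ∈ S.weak V, S.nrm (L v) ≤ C * S.rhs k v}
  add_mem' := by
    rintro L L' ⟨C, hC, h⟩ ⟨C', hC', h'⟩
    refine ⟨C + C', add_nonneg hC hC', fun v hv => ?_⟩
    rw [add_mul]
    exact (S.nrm_add_le _ _).trans (add_le_add (h v hv) (h' v hv))
  zero_mem' := ⟨0, le_rfl, fun v _ => by simp [nrm]⟩
  smul_mem' := by
    rintro a L ⟨C, hC, h⟩
    obtain ⟨C', hC', h'⟩ := S.exists_nrm_mul_le a
    refine ⟨C' * C, mul_nonneg hC' hC, fun v hv => (h' _).trans ?_⟩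
    rw [mul_assoc]
    exact mul_le_mul_of_nonneg_left (h v hv) hC'

variable {S} {V : Ideal A} {k : ℕ}

lemma HasOrder.mem_controlled {L : Module.End ℝ A} (h : S.HasOrder (k + 1) L) :
    L ∈ S.controlled V k := by
  obtain ⟨C, hC, h⟩ := h 0
  refine ⟨C, hC, fun v _ => ?_⟩
  have := h v
  rw [sob_zero, zero_add] at this
  exact this.trans (mul_le_mul_of_nonneg_left (le_add_of_nonneg_left (S.sob_nonneg _ _)) hC)

lemma HasOrder.mul_lap_mem_controlled {L : Module.End ℝ A} (h : S.HasOrder k L) :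
    L * S.lap ∈ S.controlled V k := by
  obtain ⟨C, hC, h⟩ := h 0
  refine ⟨C, hC, fun v _ => ?_⟩
  have := h (S.lap v)
  rw [sob_zero, zero_add] at this
  exact this.trans (mul_le_mul_of_nonneg_left (le_add_of_nonneg_right (S.sob_nonneg _ _)) hC)

lemma der_word_mem_controlled (hV : S.Invariant V) {α : List (Fin d → A)}
    (hα : ∀ X ∈ α, S.Tangent X) (hk : α.length = k + 1) (j : Fin d) :
    S.D j * S.word α ∈ S.controlled V k := by
  obtain ⟨C, hC, h⟩ := S.exists_abs_energy_word_le hV k hα [] (by simp) (by simpa using hk)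
  refine ⟨d * C, by positivity, fun v hv => (S.nrm_der_le j _).trans ?_⟩
  have h₁ := h v hv _ (hV.word_mem hα hv.1)
  rw [word_nil, Module.End.one_apply] at h₁
  have h₂ := S.gradNrm_sq_le (S.word α v)
  have h₃ := mul_le_mul_of_nonneg_left ((le_abs_self _).trans h₁) (Nat.cast_nonneg (α := ℝ) d)
  rcases (S.gradNrm_nonneg (S.word α v)).eq_or_lt with h₀ | h₀
  · rw [← h₀]
    exact mul_nonneg (by positivity) (S.rhs_nonneg k v)
  · refine le_of_mul_le_mul_right ?_ h₀
    nlinarith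

/-! ### All derivatives -/

lemma word_mem_controlled_of_perm {l l' : List (Fin d → A)} (h : l.Perm l')
    (hk : l.length = k + 2) (h' : S.word l' ∈ S.controlled V k) :
    S.word l ∈ S.controlled V k := by
  have := Submodule.add_mem _
    ((S.hasOrder_word_sub h (k + 1) hk).mem_controlled (V := V)) h'
  rwa [sub_add_cancel] at this

lemma mem_controlled_of_smul {L : Module.End ℝ A}
    (h : ((∑ l, S.der l S.defFun ^ 2) ^ 2 + S.defFun ^ 2) • L ∈ S.controlled V k) :
    L ∈ S.controlled V k := by
  obtain ⟨C, hC, h⟩ := h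
  obtain ⟨C', hC', h'⟩ := S.exists_lower_bound
  refine ⟨√C' * C, mul_nonneg (Real.sqrt_nonneg _) hC, fun v hv => ?_⟩
  rw [mul_assoc]
  refine le_trans ?_ (mul_le_mul_of_nonneg_left (h v hv) (Real.sqrt_nonneg _))
  rw [nrm, nrm, ← Real.sqrt_mul hC']
  exact Real.sqrt_le_sqrt (h' _)

variable (S) in
/-- The vector field `∂ᵢρ ∂ⱼ - ∂ⱼρ ∂ᵢ`, tangent to the level sets of the defining function. -/
def rot (i j : Fin d) : Fin d → A :=
  S.der i S.defFun • Pi.single j 1 - S.der j S.defFun • Pi.single i 1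

variable (S) in
lemma vf_rot (i j : Fin d) :
    S.vf (S.rot i j) = S.der i S.defFun • S.D j - S.der j S.defFun • S.D i := by
  rw [← S.vf_single i, ← S.vf_single j]
  ext f
  simp [vf_apply, rot, sub_mul, mul_assoc, Finset.mul_sum]

variable (S) in
lemma tangent_rot (i j : Fin d) : S.Tangent (S.rot i j) := by
  rw [Tangent, vf_rot]
  simp [D_apply, mul_comm]

variable (S) in
lemma vf_defFun_smul (i : Fin d) :
    S.vf (S.defFun • Pi.single i 1) = S.defFun • S.D i := by
  rw [← S.vf_single i]
  ext f
  simp [vf_apply, mul_assoc, Finset.mul_sum]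

variable (S) in
lemma tangent_defFun_smul (i : Fin d) : S.Tangent (S.defFun • Pi.single i 1) := by
  rw [Tangent, vf_defFun_smul, LinearMap.smul_apply]
  exact S.boundary.mul_mem_right _ S.defFun_mem

variable (S) in
lemma D_mul_D_comm (i j : Fin d) : S.D i * S.D j = S.D j * S.D i :=
  LinearMap.ext fun f => S.der_comm i j f

/-- Second derivatives are controlled by the Laplacian and by tangential derivatives of first
derivatives. -/
lemma D_mul_D_mul_mem_controlled {P : Module.End ℝ A}
    (hlap : S.lap * P ∈ S.controlled V k)
    (htan : ∀ X, S.Tangent X → ∀ c, S.vf X * (S.D c * P) ∈ S.controlled V k) (a b : Fin d) :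
    S.D a * (S.D b * P) ∈ S.controlled V k := by
  set K := S.controlled V k
  set r : Fin d → A := fun i => S.der i S.defFun
  set G : A := ∑ l, r l ^ 2 with hG
  set g : Fin d → Fin d → Module.End ℝ A := fun a b => S.D a * (S.D b * P) with hg
  have g_symm : ∀ a b, g a b = g b a := fun a b => by
    simp only [hg, ← mul_assoc, S.D_mul_D_comm a b]
  set n : Fin d → Module.End ℝ A := fun b => ∑ c, r c • g c b with hn
  have h₁ : ∀ a b, G • g a b - r a • n b ∈ K := fun a b => by
    have e : G • g a b - r a • n b = ∑ i, r i • (S.vf (S.rot i a) * (S.D b * P)) := by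
      simp only [hG, hn, Finset.sum_smul, Finset.smul_sum, ← Finset.sum_sub_distrib]
      refine Finset.sum_congr rfl fun i _ => ?_
      rw [vf_rot, sub_mul, smul_sub, smul_mul_assoc, smul_mul_assoc, smul_smul, smul_smul,
        smul_smul, pow_two, mul_comm (r a)]
    rw [e]
    exact K.sum_mem fun i _ => K.smul_mem _ (htan _ (S.tangent_rot i a) b)
  have h₂ : ∑ a, r a • n a ∈ K := by
    have h := K.sub_mem (K.smul_mem G hlap) (K.sum_mem fun a (_ : a ∈ Finset.univ) => h₁ a a)
    have e : S.lap * P = ∑ a, g a a := by simp only [lap, Finset.sum_mul, hg, mul_assoc]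
    rw [e, Finset.smul_sum, ← Finset.sum_sub_distrib] at h
    simpa using h
  have h₃ : ∀ b, G • n b ∈ K := fun b => by
    have h := K.add_mem (K.sum_mem fun c (_ : c ∈ Finset.univ) => K.smul_mem (r c) (h₁ b c))
      (K.smul_mem (r b) h₂)
    have e : ∑ c, r c • (G • g b c - r b • n c) + r b • ∑ a, r a • n a = G • n b := by
      rw [hn, Finset.smul_sum, Finset.smul_sum, ← Finset.sum_add_distrib]
      refine Finset.sum_congr rfl fun c _ => ?_
      rw [g_symm b c]
      module
    rwa [e] at h
  refine mem_controlled_of_smul ?_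
  have h₄ : S.defFun • g a b ∈ K := by
    have h := htan _ (S.tangent_defFun_smul a) b
    rwa [vf_defFun_smul, smul_mul_assoc] at h
  have h := K.add_mem (K.add_mem (K.smul_mem G (h₁ a b)) (K.smul_mem (r a) (h₃ b)))
    (K.smul_mem S.defFun h₄)
  convert h using 1
  module

/-- The list of coordinate fields of a list of indices. -/
def coord (l : List (Fin d)) : List (Fin d → A) := l.map fun j => Pi.single j 1

lemma word_append_coord_mem_controlled (hV : S.Invariant V) (γ : List (Fin d)) :
    ∀ α : List (Fin d → A), (∀ X ∈ α, S.Tangent X) → α.length + γ.length = k + 2 →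
      S.word (α ++ coord γ) ∈ S.controlled V k := by
  induction hm : γ.length using Nat.strong_induction_on generalizing γ with
  | _ m ih =>
  intro α hα hk
  match γ, hm with
  | [], hm =>
    cases α with
    | nil => simp [← hm] at hk
    | cons X α =>
      simp only [coord, List.map_nil, List.append_nil, word_cons, vf, Finset.sum_mul]
      refine Submodule.sum_mem _ fun l _ => ?_
      rw [smul_mul_assoc]
      exact Submodule.smul_mem _ _ (der_word_mem_controlled hV
        (fun Y hY => hα Y (by simp [hY])) (by simp [← hm] at hk; exact hk) l)
  | [j], hm =>
    refine word_mem_controlled_of_perm (l' := Pi.single j 1 :: α) ?_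
      (by simp [coord]; simp [← hm] at hk; omega) ?_
    · exact List.perm_append_comm
    · rw [word_cons, vf_single]
      exact der_word_mem_controlled hV hα (by simp [← hm] at hk; omega) j
  | a :: b :: γ, hm =>
    have hlen : α.length + γ.length = k := by simp [← hm] at hk; omega
    set P := S.word (α ++ coord γ) with hP
    have hcc : ∀ c e, S.word (Pi.single c 1 :: Pi.single e 1 :: (α ++ coord γ)) =
        S.D c * (S.D e * P) := fun c e => by
      rw [word_cons, word_cons, vf_single, vf_single]
    refine word_mem_controlled_of_perm
      (l' := Pi.single a 1 :: Pi.single b 1 :: (α ++ coord γ)) ?_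
      (by simp [coord]; omega) ?_
    · simp only [coord, List.map_cons]
      exact List.perm_middle.trans (List.perm_middle.cons _)
    rw [hcc]
    refine D_mul_D_mul_mem_controlled ?_ (fun X hX c => ?_) a b
    · have hPk : S.HasOrder k P := by
        have := S.hasOrder_word (α ++ coord γ)
        rwa [show (α ++ coord (A := A) γ).length = k by simp [coord, hlen]] at this
      have h₁ : S.lap * P - P * S.lap ∈ S.controlled V k := by
        rw [lap, Finset.sum_mul, Finset.mul_sum, ← Finset.sum_sub_distrib]
        refine Submodule.sum_mem _ fun c _ => HasOrder.mem_controlled ?_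
        have e : S.D c * S.D c * P - P * (S.D c * S.D c) =
            S.word (Pi.single c 1 :: Pi.single c 1 :: (α ++ coord γ)) -
              S.word (α ++ coord γ ++ [Pi.single c 1, Pi.single c 1]) := by
          rw [hcc, word_append, word_cons, word_cons, word_nil, vf_single, mul_one, mul_assoc]
        rw [e]
        refine S.hasOrder_word_sub ?_ (k + 1) (by simp [coord]; omega)
        exact List.perm_append_comm (l₁ := [Pi.single c 1, Pi.single c 1])
      simpa using Submodule.add_mem _ h₁ (hPk.mul_lap_mem_controlled (V := V))
    · rw [← vf_single, ← word_cons, ← word_cons]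
      refine word_mem_controlled_of_perm (l' := (X :: α) ++ coord (c :: γ)) ?_
        (by simp [coord]; omega) ?_
      · simp only [coord, List.map_cons, List.cons_append]
        exact List.perm_middle.symm.cons X
      · refine ih (c :: γ).length (by simp [← hm]) _ rfl _ ?_ (by simp; omega)
        simpa [hX] using hα

/-! ### The a priori estimate -/

variable (S) in
lemma word_coord_apply (l : List (Fin d)) (f : A) :
    S.word (coord l) f = opIter (fun j g => S.der j g) l f := by
  induction l with
  | nil => rfl
  | cons j l ih =>
    simp only [coord, List.map_cons, word_cons, vf_single, Module.End.mul_apply, opIter] at ih ⊢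
    rw [ih, D_apply]

lemma exists_sob_le_rhs (hV : S.Invariant V) (k : ℕ) :
    ∃ C, 0 ≤ C ∧ ∀ v ∈ S.weak V, S.sob (k + 2) v ≤ C * S.rhs k v := by
  have h : ∀ σ : Fin (k + 2) → Fin d, ∃ C, 0 ≤ C ∧ ∀ v ∈ S.weak V,
      S.nrm (opIter (fun j g => S.der j g) (List.ofFn σ) v) ≤ C * S.rhs k v := fun σ => by
    obtain ⟨C, hC, h⟩ :=
      word_append_coord_mem_controlled (k := k) hV (List.ofFn σ) [] (by simp) (by simp)
    exact ⟨C, hC, by simpa only [List.nil_append, word_coord_apply] using h⟩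
  choose C hC h using h
  refine ⟨1 + ∑ σ, C σ, add_nonneg zero_le_one (Finset.sum_nonneg fun σ _ => hC σ),
    fun v hv => ?_⟩
  rw [sob, wordSum, Finset.sum_range_succ, add_mul, Finset.sum_mul, one_mul]
  exact add_le_add (le_add_of_nonneg_left (S.sob_nonneg _ _))
    (Finset.sum_le_sum fun σ _ => h σ v hv)

lemma exists_sob_one_le :
    ∃ C, 0 ≤ C ∧ ∀ v ∈ S.weak V, S.sob 1 v ≤ C * (S.nrm (S.lap v) + S.nrm v) := by
  refine ⟨1 + d, by positivity, fun v hv => ?_⟩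
  have h₁ := S.gradNrm_sq_le v
  have h₂ := (neg_le_abs _).trans (S.abs_integral_mul_le (S.lap v) v)
  rw [← hv.2 v hv.1] at h₂
  have h₃ := mul_le_mul_of_nonneg_left h₂ (Nat.cast_nonneg (α := ℝ) d)
  have e : S.sob 1 v = S.nrm v + S.gradNrm v := by
    simp only [S.sob_succ 0, sob_zero, gradNrm]
  have ha := S.nrm_nonneg v
  have hb := S.nrm_nonneg (S.lap v)
  have hd : (d : ℝ) ≤ (d : ℝ) ^ 2 := by exact_mod_cast Nat.le_self_pow two_ne_zero d
  have h₄ : S.gradNrm v ≤ d * (S.nrm (S.lap v) + S.nrm v) := by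
    refine abs_le_of_sq_le_sq' ?_ (by positivity) |>.2
    nlinarith [mul_nonneg ha hb, mul_nonneg (sub_nonneg.2 hd) (mul_nonneg ha hb),
      mul_nonneg (sq_nonneg (d : ℝ)) (sq_nonneg (S.nrm v)),
      mul_nonneg (sq_nonneg (d : ℝ)) (sq_nonneg (S.nrm (S.lap v))),
      mul_nonneg (sq_nonneg (d : ℝ)) (mul_nonneg ha hb)]
  rw [e]
  linarith

/-- The elliptic a priori estimate. -/
theorem exists_sob_le (hV : S.Invariant V) (k : ℕ) :
    ∃ C, 0 ≤ C ∧ ∀ v ∈ S.weak V, S.sob (k + 2) v ≤ C * (S.sob k (S.lap v) + S.nrm v) := by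
  have step : ∀ k, (∃ C, 0 ≤ C ∧ ∀ v ∈ S.weak V,
      S.sob (k + 1) v ≤ C * (S.sob k (S.lap v) + S.nrm v)) → ∃ C, 0 ≤ C ∧ ∀ v ∈ S.weak V,
      S.sob (k + 2) v ≤ C * (S.sob k (S.lap v) + S.nrm v) := by
    rintro k ⟨C, hC, h⟩
    obtain ⟨C', hC', h'⟩ := exists_sob_le_rhs hV k
    refine ⟨C' * (1 + C), by positivity, fun v hv => (h' v hv).trans ?_⟩
    rw [mul_assoc]
    refine mul_le_mul_of_nonneg_left ?_ hC'
    rw [rhs]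
    linarith [h v hv, S.nrm_nonneg v]
  induction k with
  | zero => exact step 0 (by simpa only [zero_add, sob_zero] using exists_sob_one_le)
  | succ k ih =>
    refine step (k + 1) ?_
    obtain ⟨C, hC, h⟩ := ih
    refine ⟨C, hC, fun v hv => (h v hv).trans (mul_le_mul_of_nonneg_left ?_ hC)⟩
    linarith [S.sob_mono k.le_succ (S.lap v)]

variable (S) in
lemma energy_eq_of_mem {v φ : A} (h : φ * ∑ l, S.der l v * S.der l S.defFun ∈ S.boundary) :
    S.energy v φ = -S.integral (S.lap v * φ) := by
  have h := S.integral_div (fun l => φ * S.der l v)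
    (by simpa only [Finset.mul_sum, mul_assoc] using h)
  simp only [Derivation.leibniz, smul_eq_mul, Finset.sum_add_distrib, map_add] at h
  rw [← Finset.mul_sum, ← lap_apply, mul_comm, map_sum] at h
  rw [energy]
  linarith

variable (S) in
lemma exists_sob_le_of_dirichlet (k : ℕ) : ∃ C, 0 ≤ C ∧ ∀ v ∈ S.boundary,
    S.sob (k + 2) v ≤ C * (S.sob k (S.lap v) + S.nrm v) := by
  obtain ⟨C, hC, h⟩ := exists_sob_le (S := S) (V := S.boundary)
    (fun X hX f hf => by
      rw [vf_apply]
      exact S.tangent_mem X (by rwa [Tangent, vf_apply] at hX) f hf) k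
  exact ⟨C, hC, fun v hv => h v ⟨hv, fun φ hφ =>
    S.energy_eq_of_mem (S.boundary.mul_mem_right _ hφ)⟩⟩

variable (S) in
lemma exists_sob_le_of_neumann (k : ℕ) : ∃ C, 0 ≤ C ∧
    ∀ v, ∑ l, S.der l v * S.der l S.defFun ∈ S.boundary →
      S.sob (k + 2) v ≤ C * (S.sob k (S.lap v) + S.nrm v) := by
  obtain ⟨C, hC, h⟩ := exists_sob_le (S := S) (V := ⊤) (fun _ _ _ _ => Submodule.mem_top) k
  exact ⟨C, hC, fun v hv => h v ⟨Submodule.mem_top, fun φ _ =>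
    S.energy_eq_of_mem (S.boundary.mul_mem_left _ hv)⟩⟩

end EnergySpace


/-! ### Calculus on a smooth domain -/

section Calculus

variable {d : ℕ}

lemma contDiff_pd {f : (Fin d → ℝ) → ℝ} (hf : ContDiff ℝ (⊤ : ℕ∞) f) (j : Fin d) :
    ContDiff ℝ (⊤ : ℕ∞) (pd j f) :=
  (hf.fderiv_right (m := (⊤ : ℕ∞)) (by simp)).clm_apply contDiff_const

lemma fderiv_fderiv_apply_comm {E : Type*} [NormedAddCommGroup E] [NormedSpace ℝ E] {f : E → ℝ}
    (hf : ContDiff ℝ (⊤ : ℕ∞) f) (v w p : E) :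
    fderiv ℝ (fun q => fderiv ℝ f q v) p w = fderiv ℝ (fun q => fderiv ℝ f q w) p v := by
  have hd : Differentiable ℝ (fderiv ℝ f) :=
    (hf.fderiv_right (m := (⊤ : ℕ∞)) (by simp)).differentiable (by simp)
  have h : ∀ v w, fderiv ℝ (fun q => fderiv ℝ f q v) p w = fderiv ℝ (fderiv ℝ f) p w v :=
    fun v w => by
      rw [fderiv_clm_apply (hd p) (differentiableAt_const _)]
      simp
  rw [h, h]
  refine (hf.contDiffAt.isSymmSndFDerivAt ?_) _ _
  rw [minSmoothness_of_isRCLikeNormedField]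
  exact WithTop.coe_le_coe.2 (le_top : (2 : ℕ∞) ≤ ⊤)

lemma pd_comm {f : (Fin d → ℝ) → ℝ} (hf : ContDiff ℝ (⊤ : ℕ∞) f) (i j : Fin d) :
    pd i (pd j f) = pd j (pd i f) :=
  funext fun z => fderiv_fderiv_apply_comm hf _ _ z

lemma pd_add {f g : (Fin d → ℝ) → ℝ} (hf : Differentiable ℝ f) (hg : Differentiable ℝ g)
    (j : Fin d) : pd j (f + g) = pd j f + pd j g := by
  ext z
  simp [pd, fderiv_add (hf z) (hg z)]

lemma pd_mul {f g : (Fin d → ℝ) → ℝ} (hf : Differentiable ℝ f) (hg : Differentiable ℝ g)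
    (j : Fin d) : pd j (f * g) = f * pd j g + g * pd j f := by
  ext z
  simp [pd, fderiv_mul (hf z) (hg z)]

lemma fderiv_eq_sum_pd (f : (Fin d → ℝ) → ℝ) (y v : Fin d → ℝ) :
    fderiv ℝ f y v = ∑ l, v l * pd l f y := by
  conv_lhs => rw [pi_eq_sum_univ' v, map_sum]
  refine Finset.sum_congr rfl fun l _ => ?_
  rw [map_smul, smul_eq_mul]
  congr 2

lemma integral_pd_eq_zero {h : (Fin d → ℝ) → ℝ} (hh : ContDiff ℝ (⊤ : ℕ∞) h)
    (hc : HasCompactSupport h) (l : Fin d) : ∫ y, pd l h y = 0 := by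
  have hi : Integrable (pd l h) := (contDiff_pd hh l).continuous.integrable_of_hasCompactSupport
    (hc.fderiv_apply ℝ _)
  have := integral_mul_fderiv_eq_neg_fderiv_mul_of_integrable (μ := volume)
    (f := fun _ : Fin d → ℝ => (1 : ℝ)) (g := h) (v := Pi.single l 1)
    (by simp) (by simp only [one_mul]; exact hi)
    (by simpa using hh.continuous.integrable_of_hasCompactSupport hc)
    (fun x _ => differentiableAt_const _) (fun x _ => (hh.differentiable (by simp)) x)
  simpa [pd] using this

/-- A smooth cutoff on the line, equal to `1` below `-2` and to `0` above `-1`. -/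
def cutoff (s : ℝ) : ℝ := Real.smoothTransition (-s - 1)

lemma contDiff_cutoff : ContDiff ℝ (⊤ : ℕ∞) cutoff :=
  Real.smoothTransition.contDiff.comp (by fun_prop)

lemma cutoff_of_le {s : ℝ} (h : s ≤ -2) : cutoff s = 1 :=
  Real.smoothTransition.one_of_one_le (by linarith)

lemma cutoff_of_ge {s : ℝ} (h : -1 ≤ s) : cutoff s = 0 :=
  Real.smoothTransition.zero_of_nonpos (by linarith)

lemma deriv_cutoff_of_lt {s : ℝ} (h : s < -2) : deriv cutoff s = 0 := by
  have : cutoff =ᶠ[nhds s] fun _ => 1 := by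
    filter_upwards [Iio_mem_nhds h] with t ht using cutoff_of_le (le_of_lt ht)
  rw [this.deriv_eq, deriv_const]

lemma deriv_cutoff_of_gt {s : ℝ} (h : -1 < s) : deriv cutoff s = 0 := by
  have : cutoff =ᶠ[nhds s] fun _ => 0 := by
    filter_upwards [Ioi_mem_nhds h] with t ht using cutoff_of_ge (le_of_lt ht)
  rw [this.deriv_eq, deriv_const]

lemma exists_abs_mul_deriv_cutoff_le : ∃ K, 0 ≤ K ∧ ∀ s, |s * deriv cutoff s| ≤ K := by
  have hc : Continuous fun s => s * deriv cutoff s :=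
    continuous_id.mul (contDiff_cutoff.continuous_deriv (by simp))
  obtain ⟨K, hK⟩ := (isCompact_Icc (a := (-2 : ℝ)) (b := -1)).exists_bound_of_continuousOn
    hc.continuousOn
  refine ⟨max K 0, le_max_right _ _, fun s => ?_⟩
  by_cases h₁ : s < -2
  · simp [deriv_cutoff_of_lt h₁]
  by_cases h₂ : -1 < s
  · simp [deriv_cutoff_of_gt h₂]
  exact (hK s ⟨not_lt.1 h₁, not_lt.1 h₂⟩).trans (le_max_left _ _)

end Calculus

namespace SmoothDomain

variable {d : ℕ} (D : SmoothDomain d)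

lemma isCompact_closure : IsCompact (closure D.carrier) := D.isBounded.isCompact_closure

lemma defFun_neg {y : Fin d → ℝ} (hy : y ∈ D.carrier) : D.defFun y < 0 := by
  rwa [D.carrier_eq] at hy

lemma mem_frontier_iff {y : Fin d → ℝ} : y ∈ frontier D.carrier ↔ D.defFun y = 0 := by
  rw [D.frontier_eq]; rfl

lemma mem_carrier_or_mem_frontier {y : Fin d → ℝ} (hy : y ∈ closure D.carrier) :
    y ∈ D.carrier ∨ y ∈ frontier D.carrier := by
  rw [closure_eq_self_union_frontier] at hy
  exact hy

lemma integrableOn {f : (Fin d → ℝ) → ℝ} (hf : Continuous f) : IntegrableOn f D.carrier :=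
  (hf.continuousOn.integrableOn_compact D.isCompact_closure).mono_set subset_closure

/-- Near a boundary point, a function vanishing on the boundary is bounded by a multiple of the
defining function. -/
lemma exists_abs_le_defFun_nhds {g : (Fin d → ℝ) → ℝ} (hg : ContDiff ℝ (⊤ : ℕ∞) g)
    (h₀ : ∀ y ∈ frontier D.carrier, g y = 0) {y₀ : Fin d → ℝ}
    (hy₀ : y₀ ∈ frontier D.carrier) :
    ∃ C, 0 ≤ C ∧ ∀ᶠ y in nhds y₀, y ∈ D.carrier → |g y| ≤ C * |D.defFun y| := by
  set ρ := D.defFun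
  have hρ : ContDiff ℝ (⊤ : ℕ∞) ρ := D.defFun_smooth
  obtain ⟨e, he⟩ : ∃ e, fderiv ℝ ρ y₀ e = 1 := by
    obtain ⟨v, hv⟩ := DFunLike.ne_iff.1 (D.grad_ne y₀ hy₀)
    refine ⟨(fderiv ℝ ρ y₀ v)⁻¹ • v, ?_⟩
    rw [map_smul, smul_eq_mul]
    exact inv_mul_cancel₀ (by simpa using hv)
  have hstrict : HasStrictFDerivAt ρ (fderiv ℝ ρ y₀) y₀ :=
    hρ.contDiffAt.hasStrictFDerivAt (by simp)
  have hc : (0 : ℝ) < 1 / (2 * (‖e‖ + 1)) := by positivity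
  obtain ⟨s, hs, happ⟩ := hstrict.approximates_deriv_on_nhds
    (c := ⟨1 / (2 * (‖e‖ + 1)), hc.le⟩) (Or.inr hc)
  obtain ⟨K, t, ht, hlip⟩ :=
    ContDiffAt.exists_lipschitzOnWith (hg.contDiffAt (x := y₀) |>.of_le (m := 1) (by simp))
  obtain ⟨r, hr, hball⟩ := Metric.mem_nhds_iff.1 (Filter.inter_mem hs ht)
  refine ⟨K * (2 * ‖e‖), by positivity, ?_⟩
  have hρ₀ : ρ y₀ = 0 := D.mem_frontier_iff.1 hy₀
  have hlim : Filter.Tendsto (fun y => ‖y - y₀‖ + 2 * |ρ y| * ‖e‖) (nhds y₀) (nhds 0) := by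
    have : Continuous fun y => ‖y - y₀‖ + 2 * |ρ y| * ‖e‖ := by
      have := hρ.continuous
      fun_prop
    simpa [hρ₀] using this.tendsto y₀
  filter_upwards [hlim.eventually_lt_const hr] with y hy hyD
  have hneg : ρ y < 0 := D.defFun_neg hyD
  rw [abs_of_neg hneg] at hy ⊢
  have hmem : ∀ τ ∈ Set.Icc 0 (-2 * ρ y), y + τ • e ∈ s ∩ t := fun τ hτ => by
    refine hball ?_
    rw [Metric.mem_ball, dist_eq_norm]
    calc ‖y + τ • e - y₀‖ = ‖(y - y₀) + τ • e‖ := by congr 1; abel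
      _ ≤ ‖y - y₀‖ + ‖τ • e‖ := norm_add_le _ _
      _ = ‖y - y₀‖ + τ * ‖e‖ := by rw [norm_smul, Real.norm_of_nonneg hτ.1]
      _ ≤ ‖y - y₀‖ + 2 * -ρ y * ‖e‖ := by
        have := mul_le_mul_of_nonneg_right hτ.2 (norm_nonneg e)
        linarith
      _ < r := hy
  have h0mem : (0 : ℝ) ∈ Set.Icc 0 (-2 * ρ y) := ⟨le_rfl, by linarith⟩
  have hymem : y ∈ s ∩ t := by simpa using hmem 0 h0mem
  have hend : 0 ≤ ρ (y + (-2 * ρ y) • e) := by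
    have hm := hmem (-2 * ρ y) ⟨by linarith, le_rfl⟩
    have h := happ (y + (-2 * ρ y) • e) hm.1 y hymem.1
    rw [add_sub_cancel_left, map_smul, he, smul_eq_mul, mul_one, norm_smul,
      Real.norm_of_nonneg (by linarith : (0 : ℝ) ≤ -2 * ρ y), Real.norm_eq_abs] at h
    have h' := (abs_le.1 h).1
    have hb : 1 / (2 * (‖e‖ + 1)) * (-2 * ρ y * ‖e‖) ≤ -ρ y := by
      rw [div_mul_eq_mul_div, one_mul, div_le_iff₀ (by positivity)]
      nlinarith [norm_nonneg e]
    change -(1 / (2 * (‖e‖ + 1)) * (-2 * ρ y * ‖e‖)) ≤ _ at h'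
    linarith
  obtain ⟨τ, hτ, hzero⟩ : ∃ τ ∈ Set.Icc 0 (-2 * ρ y), ρ (y + τ • e) = 0 := by
    have hcont : ContinuousOn (fun τ : ℝ => ρ (y + τ • e)) (Set.Icc 0 (-2 * ρ y)) := by
      have := hρ.continuous
      fun_prop
    exact intermediate_value_Icc (by linarith : (0 : ℝ) ≤ -2 * ρ y) hcont
      ⟨by simpa using hneg.le, hend⟩
  have hgz : g (y + τ • e) = 0 := h₀ _ (D.mem_frontier_iff.2 hzero)
  have h := hlip.dist_le_mul y hymem.2 (y + τ • e) (hmem τ hτ).2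
  rw [hgz, Real.dist_eq, sub_zero, dist_eq_norm, sub_add_cancel_left, norm_neg, norm_smul,
    Real.norm_of_nonneg hτ.1] at h
  refine h.trans ?_
  rw [mul_assoc]
  refine mul_le_mul_of_nonneg_left ?_ K.coe_nonneg
  have := mul_le_mul_of_nonneg_right hτ.2 (norm_nonneg e)
  linarith

/-- A smooth function vanishing on the boundary is bounded by a multiple of the defining
function. -/
lemma exists_abs_le_defFun {g : (Fin d → ℝ) → ℝ} (hg : ContDiff ℝ (⊤ : ℕ∞) g)
    (h₀ : ∀ y ∈ frontier D.carrier, g y = 0) :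
    ∃ C, 0 ≤ C ∧ ∀ y ∈ D.carrier, |g y| ≤ C * |D.defFun y| := by
  have key : ∃ C, 0 ≤ C ∧ ∀ y ∈ closure D.carrier, y ∈ D.carrier →
      |g y| ≤ C * |D.defFun y| := by
    refine D.isCompact_closure.induction_on
      (p := fun s => ∃ C, 0 ≤ C ∧ ∀ y ∈ s, y ∈ D.carrier → |g y| ≤ C * |D.defFun y|)
      ⟨0, le_rfl, by simp⟩ ?_ ?_ ?_
    · rintro s t hst ⟨C, hC, h⟩
      exact ⟨C, hC, fun y hy => h y (hst hy)⟩
    · rintro s t ⟨C, hC, h⟩ ⟨C', hC', h'⟩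
      refine ⟨C + C', add_nonneg hC hC', fun y hy hyD => ?_⟩
      rw [add_mul]
      rcases hy with hy | hy
      · exact (h y hy hyD).trans (le_add_of_nonneg_right (by positivity))
      · exact (h' y hy hyD).trans (le_add_of_nonneg_left (by positivity))
    · intro y₀ hy₀
      suffices h : ∃ C, 0 ≤ C ∧ ∀ᶠ y in nhds y₀, y ∈ D.carrier →
          |g y| ≤ C * |D.defFun y| by
        obtain ⟨C, hC, h⟩ := h
        exact ⟨_, mem_nhdsWithin_of_mem_nhds h, C, hC, fun y hy => hy⟩
      rcases D.mem_carrier_or_mem_frontier hy₀ with hy | hy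
      · have hρ := abs_pos.2 (D.defFun_neg hy).ne
        have hc : ContinuousAt (fun y => |g y| / |D.defFun y|) y₀ :=
          (hg.continuous.abs.continuousAt).div D.defFun_smooth.continuous.abs.continuousAt hρ.ne'
        refine ⟨|g y₀| / |D.defFun y₀| + 1, by positivity, ?_⟩
        filter_upwards [hc.eventually_lt_const (lt_add_one _)] with y hy hyD
        exact (div_le_iff₀ (abs_pos.2 (D.defFun_neg hyD).ne)).1 hy.le
      · exact D.exists_abs_le_defFun_nhds hg h₀ hy
  obtain ⟨C, hC, h⟩ := key
  exact ⟨C, hC, fun y hy => h y (subset_closure hy) hy⟩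

/-- The divergence theorem for vector fields tangent to the boundary. -/
lemma integral_div_eq_zero {X : Fin d → (Fin d → ℝ) → ℝ}
    (hX : ∀ l, ContDiff ℝ (⊤ : ℕ∞) (X l))
    (h₀ : ∀ y ∈ frontier D.carrier, ∑ l, X l y * pd l D.defFun y = 0) :
    ∫ y in D.carrier, ∑ l, pd l (X l) y = 0 := by
  have hρ := D.defFun_smooth
  have hdiv : Continuous fun y => ∑ l, pd l (X l) y :=
    continuous_finsetSum _ fun l _ => (contDiff_pd (hX l) l).continuous
  have hgs : ContDiff ℝ (⊤ : ℕ∞) fun y => ∑ l, X l y * pd l D.defFun y :=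
    ContDiff.sum fun l _ => (hX l).mul (contDiff_pd hρ l)
  obtain ⟨C, hC, hCg⟩ := D.exists_abs_le_defFun hgs h₀
  obtain ⟨K, hK, hKc⟩ := exists_abs_mul_deriv_cutoff_le
  set F : ℕ → (Fin d → ℝ) → ℝ := fun n y =>
    cutoff ((n + 1) * D.defFun y) * ∑ l, pd l (X l) y +
      (n + 1) * deriv cutoff ((n + 1) * D.defFun y) * ∑ l, X l y * pd l D.defFun y with hF
  have hcs : ∀ n : ℕ, ContDiff ℝ (⊤ : ℕ∞) fun y => cutoff ((n + 1) * D.defFun y) := fun n =>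
    contDiff_cutoff.comp (contDiff_const.mul hρ)
  have hF0 : ∀ n, ∫ y in D.carrier, F n y = 0 := fun n => by
    have hpd : ∀ l y, pd l (fun y => cutoff ((n + 1) * D.defFun y) * X l y) y =
        cutoff ((n + 1) * D.defFun y) * pd l (X l) y +
          (n + 1) * deriv cutoff ((n + 1) * D.defFun y) * (X l y * pd l D.defFun y) := by
      intro l y
      have h₁ : HasFDerivAt (fun y => cutoff ((n + 1) * D.defFun y))
          (deriv cutoff ((n + 1) * D.defFun y) • ((n + 1 : ℝ) • fderiv ℝ D.defFun y)) y :=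
        ((contDiff_cutoff.differentiable (by simp) _).hasDerivAt).comp_hasFDerivAt y
          (((hρ.differentiable (by simp)) y).hasFDerivAt.const_mul _)
      have h₂ : HasFDerivAt (fun y => cutoff ((n + 1) * D.defFun y) * X l y) _ y :=
        h₁.mul ((hX l).differentiable (by simp) y).hasFDerivAt
      simp only [pd]
      rw [HasFDerivAt.fderiv h₂]
      simp
      ring
    have hout : ∀ y, y ∉ D.carrier → 0 ≤ (n + 1 : ℝ) * D.defFun y := fun y hy => by
      rw [D.carrier_eq, Set.mem_ofPred_eq, not_lt] at hy
      positivity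
    have hcomp : ∀ l, HasCompactSupport
        fun y => cutoff ((n + 1) * D.defFun y) * X l y := fun l => by
      refine HasCompactSupport.of_support_subset_isCompact D.isCompact_closure
        fun y hy => subset_closure ?_
      by_contra hyD
      exact hy (by simp [cutoff_of_ge (by linarith [hout y hyD] :
        (-1 : ℝ) ≤ (n + 1) * D.defFun y)])
    have hsm : ∀ l, ContDiff ℝ (⊤ : ℕ∞) fun y => cutoff ((n + 1) * D.defFun y) * X l y :=
      fun l => (hcs n).mul (hX l)
    have e : F n = fun y => ∑ l, pd l (fun y => cutoff ((n + 1) * D.defFun y) * X l y) y := by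
      ext y
      simp only [hF, hpd, Finset.sum_add_distrib, Finset.mul_sum]
    rw [setIntegral_eq_integral_of_forall_compl_eq_zero, e, integral_finsetSum]
    · exact Finset.sum_eq_zero fun l _ => integral_pd_eq_zero (hsm l) (hcomp l) l
    · intro l _
      exact (contDiff_pd (hsm l) l).continuous.integrable_of_hasCompactSupport
        ((hcomp l).fderiv_apply ℝ _)
    · intro y hy
      have := hout y hy
      simp only [hF, cutoff_of_ge (by linarith : (-1 : ℝ) ≤ (n + 1) * D.defFun y),
        deriv_cutoff_of_gt (by linarith : (-1 : ℝ) < (n + 1) * D.defFun y), zero_mul, mul_zero,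
        add_zero]
  have hlim := tendsto_integral_of_dominated_convergence (μ := volume.restrict D.carrier)
    (F := F) (f := fun y => ∑ l, pd l (X l) y)
    (fun y => |∑ l, pd l (X l) y| + C * K) ?_ ?_ ?_ ?_
  · simp only [hF0] at hlim
    exact tendsto_nhds_unique hlim tendsto_const_nhds
  · intro n
    refine Continuous.aestronglyMeasurable ?_
    have h₁ := contDiff_cutoff.continuous_deriv (by simp)
    have h₂ := hρ.continuous
    exact ((hcs n).continuous.mul hdiv).add
      ((continuous_const.mul (h₁.comp (continuous_const.mul h₂))).mul hgs.continuous)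
  · exact D.integrableOn (hdiv.abs.add continuous_const)
  · intro n
    refine (ae_restrict_iff' D.isOpen.measurableSet).2 (Filter.Eventually.of_forall fun y hy => ?_)
    refine (norm_add_le _ _).trans (add_le_add ?_ ?_)
    · rw [norm_mul, Real.norm_eq_abs, Real.norm_eq_abs]
      refine mul_le_of_le_one_left (abs_nonneg _) ?_
      rw [cutoff, abs_of_nonneg (Real.smoothTransition.nonneg _)]
      exact Real.smoothTransition.le_one _
    · rw [Real.norm_eq_abs, abs_mul]
      calc _ ≤ |(n + 1 : ℝ) * deriv cutoff ((n + 1) * D.defFun y)| * (C * |D.defFun y|) :=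
            mul_le_mul_of_nonneg_left (hCg y hy) (abs_nonneg _)
        _ = C * |(n + 1 : ℝ) * D.defFun y * deriv cutoff ((n + 1) * D.defFun y)| := by
            simp only [abs_mul]; ring
        _ ≤ C * K := mul_le_mul_of_nonneg_left (hKc _) hC
  · refine (ae_restrict_iff' D.isOpen.measurableSet).2 (Filter.Eventually.of_forall fun y hy => ?_)
    have hneg := D.defFun_neg hy
    obtain ⟨M, hM⟩ := exists_nat_gt (2 / -D.defFun y)
    refine tendsto_const_nhds.congr' ?_
    filter_upwards [Filter.eventually_ge_atTop M] with n hn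
    have hlt : ((n : ℝ) + 1) * D.defFun y < -2 := by
      have h₁ : (M : ℝ) ≤ n := by exact_mod_cast hn
      rw [div_lt_iff₀ (by linarith)] at hM
      nlinarith
    simp only [hF, cutoff_of_le hlt.le, deriv_cutoff_of_lt hlt, one_mul, mul_zero, zero_mul,
      add_zero]

/-- A vector tangent to the boundary annihilates functions vanishing on the boundary. -/
lemma fderiv_eq_zero_of_tangent {f : (Fin d → ℝ) → ℝ} (hf : ContDiff ℝ (⊤ : ℕ∞) f)
    (h₀ : ∀ y ∈ frontier D.carrier, f y = 0) {y v : Fin d → ℝ} (hy : y ∈ frontier D.carrier)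
    (hv : fderiv ℝ D.defFun y v = 0) : fderiv ℝ f y v = 0 := by
  have hextr : IsLocalExtrOn f {x | D.defFun x = D.defFun y} y := by
    refine Or.inl ?_
    filter_upwards [self_mem_nhdsWithin] with x hx
    rw [h₀ y hy, h₀ x (D.mem_frontier_iff.2 (hx.trans (D.mem_frontier_iff.1 hy)))]
  obtain ⟨a, b, hab, h⟩ := hextr.exists_multipliers_of_hasStrictFDerivAt_1d
    (D.defFun_smooth.contDiffAt.hasStrictFDerivAt (by simp))
    (hf.contDiffAt.hasStrictFDerivAt (by simp))
  have hb : b ≠ 0 := by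
    rintro rfl
    rw [zero_smul, add_zero] at h
    rcases smul_eq_zero.1 h with ha | ha
    · exact hab (by rw [ha]; rfl)
    · exact D.grad_ne y hy ha
  have := DFunLike.congr_fun h v
  simpa [hv, hb] using this

end SmoothDomain

/-! ### The algebra of smooth functions -/

/-- The algebra of smooth functions on `ℝ^d`. -/
def smoothFun (d : ℕ) : Subalgebra ℝ ((Fin d → ℝ) → ℝ) where
  carrier := {f | ContDiff ℝ (⊤ : ℕ∞) f}
  mul_mem' := fun {f g} (hf : ContDiff ℝ (⊤ : ℕ∞) f) (hg : ContDiff ℝ (⊤ : ℕ∞) g) => hf.mul hg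
  add_mem' := fun {f g} (hf : ContDiff ℝ (⊤ : ℕ∞) f) (hg : ContDiff ℝ (⊤ : ℕ∞) g) => hf.add hg
  algebraMap_mem' r := (contDiff_const : ContDiff ℝ (⊤ : ℕ∞) fun _ : Fin d → ℝ => r)

namespace smoothFun

variable {d : ℕ}

lemma contDiff (f : smoothFun d) : ContDiff ℝ (⊤ : ℕ∞) (f : (Fin d → ℝ) → ℝ) := f.2

lemma differentiable (f : smoothFun d) : Differentiable ℝ (f : (Fin d → ℝ) → ℝ) :=
  (smoothFun.contDiff f).differentiable (by simp)

lemma continuous (f : smoothFun d) : Continuous (f : (Fin d → ℝ) → ℝ) :=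
  (smoothFun.contDiff f).continuous

/-- The partial derivative as a derivation. -/
def der (j : Fin d) : Derivation ℝ (smoothFun d) (smoothFun d) :=
  Derivation.mk'
    { toFun := fun f => ⟨pd j f, contDiff_pd (smoothFun.contDiff f) j⟩
      map_add' := fun f g => Subtype.ext
        (pd_add (smoothFun.differentiable f) (smoothFun.differentiable g) j)
      map_smul' := fun r f => Subtype.ext (by
        ext z
        simp [pd, fderiv_const_smul ((smoothFun.differentiable f z))]) }
    fun f g => Subtype.ext (pd_mul (smoothFun.differentiable f) (smoothFun.differentiable g) j)

lemma coe_der (j : Fin d) (f : smoothFun d) :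
    (der j f : (Fin d → ℝ) → ℝ) = pd j (f : (Fin d → ℝ) → ℝ) := rfl

lemma coe_sum_apply {ι : Type*} (s : Finset ι) (f : ι → smoothFun d) (y : Fin d → ℝ) :
    ((∑ i ∈ s, f i : smoothFun d) : (Fin d → ℝ) → ℝ) y =
      ∑ i ∈ s, (f i : (Fin d → ℝ) → ℝ) y := by
  rw [AddSubmonoidClass.coe_finsetSum, Finset.sum_apply]

end smoothFun

namespace SmoothDomain

variable {d : ℕ} (D : SmoothDomain d)

lemma exists_sq_integral_le_of_abs_le {f g : (Fin d → ℝ) → ℝ} (hf : Continuous f)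
    (hg : Continuous g) {M : ℝ} (h : ∀ y ∈ closure D.carrier, |f y| ≤ M * |g y|) :
    ∫ y in D.carrier, f y * f y ≤ M ^ 2 * ∫ y in D.carrier, g y * g y := by
  rw [← integral_const_mul]
  refine setIntegral_mono_on (D.integrableOn (hf.mul hf))
    (D.integrableOn (continuous_const.mul (hg.mul hg))) D.isOpen.measurableSet fun y hy => ?_
  have h := h y (subset_closure hy)
  calc f y * f y = |f y| * |f y| := (abs_mul_abs_self _).symm
    _ ≤ (M * |g y|) * (M * |g y|) := mul_self_le_mul_self (abs_nonneg _) h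
    _ = M ^ 2 * (|g y| * |g y|) := by ring
    _ = M ^ 2 * (g y * g y) := by rw [abs_mul_abs_self]

lemma weight_pos {y : Fin d → ℝ} (hy : y ∈ closure D.carrier) :
    0 < (∑ l, pd l D.defFun y ^ 2) ^ 2 + D.defFun y ^ 2 := by
  rcases D.mem_carrier_or_mem_frontier hy with hy | hy
  · have := (D.defFun_neg hy).ne
    positivity
  · have h : ∃ l, pd l D.defFun y ≠ 0 := by
      by_contra! h
      refine D.grad_ne y hy (ContinuousLinearMap.ext fun v => ?_)
      simp [fderiv_eq_sum_pd, h]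
    obtain ⟨l, hl⟩ := h
    have : 0 < ∑ l, pd l D.defFun y ^ 2 :=
      Finset.sum_pos' (fun _ _ => sq_nonneg _) ⟨l, Finset.mem_univ l, by positivity⟩
    positivity

/-- The smooth functions near the closure of a smooth domain form an `EnergySpace`. -/
def energySpace : EnergySpace (smoothFun d) d where
  der := smoothFun.der
  der_comm i j f := Subtype.ext (pd_comm (smoothFun.contDiff f) i j)
  integral :=
    { toFun := fun f => ∫ y in D.carrier, (f : (Fin d → ℝ) → ℝ) y
      map_add' := fun f g => integral_add (D.integrableOn (smoothFun.continuous f))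
        (D.integrableOn (smoothFun.continuous g))
      map_smul' := fun r f => integral_const_mul r _ }
  integral_nonneg f := integral_nonneg fun y => mul_self_nonneg _
  exists_mul_bound a := by
    obtain ⟨M, hM⟩ := D.isCompact_closure.exists_bound_of_continuousOn
      (smoothFun.continuous a).continuousOn
    refine ⟨M ^ 2, sq_nonneg M, fun f => ?_⟩
    refine D.exists_sq_integral_le_of_abs_le (smoothFun.continuous (a * f))
      (smoothFun.continuous f) fun y hy => ?_
    change |(a : (Fin d → ℝ) → ℝ) y * (f : (Fin d → ℝ) → ℝ) y| ≤ _
    rw [abs_mul]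
    exact mul_le_mul_of_nonneg_right (hM y hy) (abs_nonneg _)
  defFun := ⟨D.defFun, D.defFun_smooth⟩
  boundary :=
    { carrier := {f | ∀ y ∈ frontier D.carrier, (f : (Fin d → ℝ) → ℝ) y = 0}
      add_mem' := fun {f g} hf hg y hy => by
        change (f : (Fin d → ℝ) → ℝ) y + (g : (Fin d → ℝ) → ℝ) y = 0
        rw [hf y hy, hg y hy, add_zero]
      zero_mem' := fun y _ => rfl
      smul_mem' := fun a f hf y hy => by
        change (a : (Fin d → ℝ) → ℝ) y * (f : (Fin d → ℝ) → ℝ) y = 0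
        rw [hf y hy, mul_zero] }
  defFun_mem y hy := D.mem_frontier_iff.1 hy
  integral_div X hX := by
    change ∫ y in D.carrier, _ = 0
    simp only [smoothFun.coe_sum_apply, smoothFun.coe_der]
    refine D.integral_div_eq_zero (fun l => smoothFun.contDiff (X l)) fun y hy => ?_
    have := hX y hy
    rwa [smoothFun.coe_sum_apply] at this
  tangent_mem X hX f hf y hy := by
    have h := hX y hy
    rw [smoothFun.coe_sum_apply] at h ⊢
    have h' := D.fderiv_eq_zero_of_tangent (smoothFun.contDiff f) hf hy
      (v := fun l => (X l : (Fin d → ℝ) → ℝ) y) (by rw [fderiv_eq_sum_pd]; exact h)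
    rw [fderiv_eq_sum_pd] at h'
    exact h'
  exists_lower_bound := by
    set w : smoothFun d := (∑ l, smoothFun.der l ⟨D.defFun, D.defFun_smooth⟩ ^ 2) ^ 2 +
      (⟨D.defFun, D.defFun_smooth⟩ : smoothFun d) ^ 2 with hw
    have hwy : ∀ y, (w : (Fin d → ℝ) → ℝ) y =
        (∑ l, pd l D.defFun y ^ 2) ^ 2 + D.defFun y ^ 2 := fun y => by
      rw [hw]
      change ((∑ l, smoothFun.der l ⟨D.defFun, D.defFun_smooth⟩ ^ 2 : smoothFun d) :
        (Fin d → ℝ) → ℝ) y ^ 2 + D.defFun y ^ 2 = _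
      rw [smoothFun.coe_sum_apply]
      rfl
    have hpos : ∀ y ∈ closure D.carrier, 0 < (w : (Fin d → ℝ) → ℝ) y := fun y hy => by
      rw [hwy]; exact D.weight_pos hy
    obtain ⟨M, hM⟩ := D.isCompact_closure.exists_bound_of_continuousOn
      ((smoothFun.continuous w).continuousOn.inv₀ fun y hy => (hpos y hy).ne')
    refine ⟨M ^ 2, sq_nonneg M, fun f => ?_⟩
    refine D.exists_sq_integral_le_of_abs_le (smoothFun.continuous f)
      (smoothFun.continuous (w * f)) fun y hy => ?_
    change _ ≤ M * |(w : (Fin d → ℝ) → ℝ) y * (f : (Fin d → ℝ) → ℝ) y|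
    have hM := hM y hy
    have hp := hpos y hy
    rw [Pi.inv_apply, norm_inv, Real.norm_of_nonneg hp.le] at hM
    rw [abs_mul, abs_of_pos hp, ← mul_assoc]
    refine le_mul_of_one_le_left (abs_nonneg _) ?_
    rwa [inv_le_iff_one_le_mul₀ hp] at hM

end SmoothDomain

namespace EnergySpace

variable {A : Type*} [CommRing A] [Algebra ℝ A] {d : ℕ} (S : EnergySpace A d)

lemma sob_neg (m : ℕ) (f : A) : S.sob m (-f) = S.sob m f := by
  induction m generalizing f with
  | zero => simp only [sob_zero, nrm, neg_mul_neg]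
  | succ m ih => simp only [sob_succ, map_neg, ih, nrm, neg_mul_neg]

lemma sob_sub_le (m : ℕ) (f g : A) : S.sob m (f - g) ≤ S.sob m f + S.sob m g := by
  rw [sub_eq_add_neg, ← S.sob_neg m g]
  exact S.sob_add_le m f (-g)

end EnergySpace

/-! ### Functions on the waveguide -/

section Waveguide

variable {d : ℕ} {u : (Fin 4 → ℝ) → (Fin d → ℝ) → ℝ}

namespace SmoothC

lemma pdtx_eq (hu : SmoothC u) (i : Fin 4) (z : Fin 4 → ℝ) (y : Fin d → ℝ) :
    pdtx i u z y = fderiv ℝ (fun p : (Fin 4 → ℝ) × (Fin d → ℝ) => u p.1 p.2) (z, y)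
      (Pi.single i 1, 0) := by
  have h : HasFDerivAt (fun z' => u z' y) _ z :=
    HasFDerivAt.comp (f := fun z' => (z', y)) z
      (hu.differentiable (by simp) (z, y)).hasFDerivAt (hasFDerivAt_prodMk_left z y)
  rw [pdtx, h.fderiv]
  simp

lemma pdy_eq (hu : SmoothC u) (j : Fin d) (z : Fin 4 → ℝ) (y : Fin d → ℝ) :
    pdy j u z y = fderiv ℝ (fun p : (Fin 4 → ℝ) × (Fin d → ℝ) => u p.1 p.2) (z, y)
      (0, Pi.single j 1) := by
  have h : HasFDerivAt (fun y' => u z y') _ y :=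
    HasFDerivAt.comp (f := fun y' => (z, y')) y
      (hu.differentiable (by simp) (z, y)).hasFDerivAt (hasFDerivAt_prodMk_right z y)
  rw [pdy, h.fderiv]
  simp

lemma contDiff_fderiv_apply (hu : SmoothC u) (v : (Fin 4 → ℝ) × (Fin d → ℝ)) :
    ContDiff ℝ (⊤ : ℕ∞) fun q =>
      fderiv ℝ (fun p : (Fin 4 → ℝ) × (Fin d → ℝ) => u p.1 p.2) q v :=
  (ContDiff.fderiv_right hu (m := (⊤ : ℕ∞)) (by simp)).clm_apply contDiff_const

lemma pdtx (hu : SmoothC u) (i : Fin 4) : SmoothC (pdtx i u) := by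
  unfold SmoothC
  simp only [hu.pdtx_eq]
  exact hu.contDiff_fderiv_apply _

lemma pdy (hu : SmoothC u) (j : Fin d) : SmoothC (pdy j u) := by
  unfold SmoothC
  simp only [hu.pdy_eq]
  exact hu.contDiff_fderiv_apply _

lemma wBox (hu : SmoothC u) : SmoothC (wBox u) := by
  have h (i : Fin 4) : SmoothC (_root_.pdtx i (_root_.pdtx i u)) := (hu.pdtx i).pdtx i
  exact ((((h 0).sub (h 1)).sub (h 2)).sub (h 3)).sub
    (ContDiff.sum fun j _ => (hu.pdy j).pdy j)

lemma pdtx_comm (hu : SmoothC u) (i j : Fin 4) :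
    _root_.pdtx i (_root_.pdtx j u) = _root_.pdtx j (_root_.pdtx i u) := by
  ext z y
  rw [(hu.pdtx j).pdtx_eq, (hu.pdtx i).pdtx_eq]
  simp only [hu.pdtx_eq]
  exact fderiv_fderiv_apply_comm hu _ _ _

lemma pdtx_pdy_comm (hu : SmoothC u) (i : Fin 4) (j : Fin d) :
    _root_.pdtx i (_root_.pdy j u) = _root_.pdy j (_root_.pdtx i u) := by
  ext z y
  rw [(hu.pdy j).pdtx_eq, (hu.pdtx i).pdy_eq]
  simp only [hu.pdtx_eq, hu.pdy_eq]
  exact fderiv_fderiv_apply_comm hu _ _ _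

lemma differentiable_left (hu : SmoothC u) (y : Fin d → ℝ) : Differentiable ℝ fun z => u z y :=
  (ContDiff.differentiable hu (by simp)).comp
    (differentiable_id.prodMk (differentiable_const y))

lemma wBox_pdtx (hu : SmoothC u) (i : Fin 4) :
    _root_.wBox (_root_.pdtx i u) = _root_.pdtx i (_root_.wBox u) := by
  ext z y
  have h (j : Fin 4) : DifferentiableAt ℝ (fun z => _root_.pdtx j (_root_.pdtx j u) z y) z :=
    ((hu.pdtx j).pdtx j).differentiable_left y z
  have h' (j : Fin d) : DifferentiableAt ℝ (fun z => _root_.pdy j (_root_.pdy j u) z y) z :=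
    ((hu.pdy j).pdy j).differentiable_left y z
  have hx (j : Fin 4) : _root_.pdtx j (_root_.pdtx j (_root_.pdtx i u)) =
      _root_.pdtx i (_root_.pdtx j (_root_.pdtx j u)) := by
    rw [hu.pdtx_comm j i, (hu.pdtx j).pdtx_comm j i]
  have hy (j : Fin d) : _root_.pdy j (_root_.pdy j (_root_.pdtx i u)) =
      _root_.pdtx i (_root_.pdy j (_root_.pdy j u)) := by
    rw [← hu.pdtx_pdy_comm i j, ← (hu.pdy j).pdtx_pdy_comm i j]
  have e : HasFDerivAt (fun z => _root_.wBox u z y) _ z :=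
    ((((h 0).hasFDerivAt.sub (h 1).hasFDerivAt).sub (h 2).hasFDerivAt).sub
      (h 3).hasFDerivAt).sub (HasFDerivAt.fun_sum fun j _ => (h' j).hasFDerivAt)
  conv_rhs => rw [_root_.pdtx, e.fderiv]
  simp only [_root_.wBox, hx, hy, sub_apply, sum_apply]
  rfl

/-- The function of `y` obtained by freezing `(t,x)`. -/
def slice (hu : SmoothC u) (z : Fin 4 → ℝ) : smoothFun d :=
  ⟨u z, ContDiff.comp (g := fun p : (Fin 4 → ℝ) × (Fin d → ℝ) => u p.1 p.2) hu
    (contDiff_const.prodMk contDiff_id)⟩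

end SmoothC

variable {D : SmoothDomain d}

lemma DirichletBC.pdtx (h : DirichletBC D u) (i : Fin 4) : DirichletBC D (pdtx i u) :=
  fun z y hy => by
    have e : (fun z' => u z' y) = fun _ => 0 := funext fun z' => h z' y hy
    simp [_root_.pdtx, e]

lemma NeumannBC.pdtx (hu : SmoothC u) (h : NeumannBC D u) (i : Fin 4) :
    NeumannBC D (pdtx i u) := fun z y hy => by
  have e : (fun z' => D.nder (u z') y) = fun _ => 0 := funext fun z' => h z' y hy
  have e' : HasFDerivAt (fun z' => D.nder (u z') y) _ z :=
    HasFDerivAt.fun_sum fun j _ =>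
      ((hu.pdy j).differentiable_left y z).hasFDerivAt.const_mul
        (fderiv ℝ D.defFun y (Pi.single j 1))
  rw [e] at e'
  have e'' := DFunLike.congr_fun (e'.unique (hasFDerivAt_const 0 z)) (Pi.single i 1)
  simp only [sum_apply, smul_apply, smul_eq_mul,
    zero_apply] at e''
  rw [← e'']
  refine Finset.sum_congr rfl fun j _ => ?_
  congr 1
  exact (congr_fun (congr_fun (hu.pdtx_pdy_comm i j) z) y).symm

lemma L2y_nonneg (u : (Fin 4 → ℝ) → (Fin d → ℝ) → ℝ) (z : Fin 4 → ℝ) : 0 ≤ L2y D u z :=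
  Real.sqrt_nonneg _

lemma SmoothC.nrm_slice (hu : SmoothC u) (z : Fin 4 → ℝ) :
    D.energySpace.nrm (hu.slice z) = L2y D u z := by
  unfold L2y
  simp only [pow_two]
  rfl

lemma SmoothC.sob_slice (hu : SmoothC u) (m : ℕ) (z : Fin 4 → ℝ) :
    D.energySpace.sob m (hu.slice z) =
      wordSum _root_.pdy (fun u => L2y D u z) (m + 1) u := by
  induction m generalizing u with
  | zero =>
    rw [EnergySpace.sob_zero, hu.nrm_slice]
    simp [wordSum, opIter]
  | succ m ih =>
    rw [EnergySpace.sob_succ, wordSum_succ, hu.nrm_slice]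
    congr 1
    exact Finset.sum_congr rfl fun j _ => ih (hu.pdy j)

lemma wordSum_pdy_le_wordSum_pdmix
    {p : ((Fin 4 → ℝ) → (Fin d → ℝ) → ℝ) → ℝ} (hp : ∀ u, 0 ≤ p u) (m : ℕ)
    (u : (Fin 4 → ℝ) → (Fin d → ℝ) → ℝ) : wordSum pdy p m u ≤ wordSum pdmix p m u := by
  induction m generalizing u with
  | zero => simp [wordSum]
  | succ m ih =>
    rw [wordSum_succ, wordSum_succ, Fintype.sum_sum_type]
    have h₁ := Finset.sum_le_sum fun j (_ : j ∈ Finset.univ) => ih (pdy j u)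
    have h₂ := Finset.sum_nonneg fun (i : Fin 4) (_ : i ∈ Finset.univ) =>
      wordSum_nonneg (F := pdmix) hp m (pdmix (Sum.inl i) u)
    change _ ≤ p u + (_ + ∑ j, wordSum pdmix p m (pdy j u))
    linarith

lemma wordSum_apply_apply_le {α γ : Type*} [Fintype α] {F : α → γ → γ} {p : γ → ℝ}
    (hp : ∀ u, 0 ≤ p u) (m : ℕ) (i : α) (u : γ) :
    wordSum F p (m - 1) (F i (F i u)) ≤ wordSum F p (m + 1) u := by
  cases m with
  | zero => simpa [wordSum, opIter] using hp u
  | succ m => exact (wordSum_apply_le hp m i _).trans (wordSum_apply_le hp _ i u)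

lemma SmoothC.lap_slice (hu : SmoothC u) (z : Fin 4 → ℝ) :
    D.energySpace.lap (hu.slice z) = ((hu.pdtx 0).pdtx 0).slice z -
      ((hu.pdtx 1).pdtx 1).slice z - ((hu.pdtx 2).pdtx 2).slice z -
      ((hu.pdtx 3).pdtx 3).slice z - hu.wBox.slice z := by
  rw [EnergySpace.lap_apply]
  refine Subtype.ext (funext fun y => ?_)
  rw [smoothFun.coe_sum_apply]
  change ∑ j, _root_.pdy j (_root_.pdy j u) z y = _root_.pdtx 0 (_root_.pdtx 0 u) z y -
    _root_.pdtx 1 (_root_.pdtx 1 u) z y - _root_.pdtx 2 (_root_.pdtx 2 u) z y -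
    _root_.pdtx 3 (_root_.pdtx 3 u) z y - _root_.wBox u z y
  rw [_root_.wBox, sub_sub_cancel]

/-- Elliptic regularity on the cross-section under either boundary condition. -/
lemma SmoothDomain.exists_sob_slice_le (D : SmoothDomain d) (k : ℕ) :
    ∃ C, 0 ≤ C ∧ ∀ (u : (Fin 4 → ℝ) → (Fin d → ℝ) → ℝ) (hu : SmoothC u),
      (DirichletBC D u ∨ NeumannBC D u) → ∀ z,
        D.energySpace.sob (k + 2) (hu.slice z) ≤
          C * (D.energySpace.sob k (D.energySpace.lap (hu.slice z)) +
            D.energySpace.nrm (hu.slice z)) := by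
  obtain ⟨C, hC, h⟩ := D.energySpace.exists_sob_le_of_dirichlet k
  obtain ⟨C', hC', h'⟩ := D.energySpace.exists_sob_le_of_neumann k
  refine ⟨max C C', hC.trans (le_max_left _ _), fun u hu hbc z => ?_⟩
  have hnn := add_nonneg (D.energySpace.sob_nonneg k (D.energySpace.lap (hu.slice z)))
    (D.energySpace.nrm_nonneg (hu.slice z))
  rcases hbc with hbc | hbc
  · exact (h (hu.slice z) (hbc z)).trans
      (mul_le_mul_of_nonneg_right (le_max_left _ _) hnn)
  · refine (h' (hu.slice z) fun y hy => ?_).trans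
      (mul_le_mul_of_nonneg_right (le_max_right _ _) hnn)
    rw [smoothFun.coe_sum_apply, ← hbc z y hy]
    exact Finset.sum_congr rfl fun l _ => mul_comm _ _

lemma SmoothDomain.exists_wordSum_pdy_le (D : SmoothDomain d) (k : ℕ) :
    ∃ C, 0 ≤ C ∧ ∀ u : (Fin 4 → ℝ) → (Fin d → ℝ) → ℝ, SmoothC u →
      (DirichletBC D u ∨ NeumannBC D u) → ∀ z,
        wordSum pdy (fun u => L2y D u z) (2 * k + 1) u ≤
          C * (wordSum pdtx (fun u => L2y D u z) (2 * k + 1) u +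
            wordSum pdmix (fun u => L2y D u z) (2 * k - 1) (wBox u)) := by
  induction k with
  | zero => exact ⟨1, zero_le_one, fun u _ _ z => by simp [wordSum, opIter]⟩
  | succ k ih =>
    obtain ⟨C, hC, ih⟩ := ih
    obtain ⟨K, hK, hell⟩ := D.exists_sob_slice_le (2 * k)
    refine ⟨K * (4 * C + 1), by positivity, fun u hu hbc z => ?_⟩
    have hp : ∀ u, 0 ≤ L2y D u z := fun u => L2y_nonneg u z
    rw [show 2 * (k + 1) + 1 = 2 * k + 2 + 1 by ring, show 2 * (k + 1) - 1 = 2 * k + 1 by omega,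
      ← hu.sob_slice]
    set W := wordSum pdtx (fun u => L2y D u z) (2 * k + 2 + 1) u
    set M := wordSum pdmix (fun u => L2y D u z) (2 * k + 1) (wBox u)
    have hder (i : Fin 4) : D.energySpace.sob (2 * k) (((hu.pdtx i).pdtx i).slice z) ≤
        C * (W + M) := by
      rw [SmoothC.sob_slice]
      refine (ih _ ((hu.pdtx i).pdtx i) (hbc.imp (fun h => (h.pdtx i).pdtx i)
        fun h => (h.pdtx hu i).pdtx (hu.pdtx i) i) z).trans
        (mul_le_mul_of_nonneg_left (add_le_add ?_ ?_) hC)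
      · exact wordSum_apply_apply_le hp (2 * k + 2) i u
      · rw [(hu.pdtx i).wBox_pdtx, hu.wBox_pdtx]
        exact wordSum_apply_apply_le (F := pdmix) hp (2 * k) (Sum.inl i) (wBox u)
    have hbox : D.energySpace.sob (2 * k) (hu.wBox.slice z) ≤ M := by
      rw [SmoothC.sob_slice]
      exact wordSum_pdy_le_wordSum_pdmix hp _ _
    have hnrm : D.energySpace.nrm (hu.slice z) ≤ W := by
      rw [hu.nrm_slice]
      have e : wordSum pdtx (fun u => L2y D u z) 1 u = L2y D u z := by simp [wordSum, opIter]
      exact e.ge.trans (wordSum_mono hp (by omega) u)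
    refine (hell u hu hbc z).trans ?_
    rw [mul_assoc]
    refine mul_le_mul_of_nonneg_left ?_ hK
    rw [hu.lap_slice]
    have s₄ := D.energySpace.sob_sub_le (2 * k) (((hu.pdtx 0).pdtx 0).slice z -
      ((hu.pdtx 1).pdtx 1).slice z - ((hu.pdtx 2).pdtx 2).slice z -
      ((hu.pdtx 3).pdtx 3).slice z) (hu.wBox.slice z)
    have s₃ := D.energySpace.sob_sub_le (2 * k) (((hu.pdtx 0).pdtx 0).slice z -
      ((hu.pdtx 1).pdtx 1).slice z - ((hu.pdtx 2).pdtx 2).slice z)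
      (((hu.pdtx 3).pdtx 3).slice z)
    have s₂ := D.energySpace.sob_sub_le (2 * k) (((hu.pdtx 0).pdtx 0).slice z -
      ((hu.pdtx 1).pdtx 1).slice z) (((hu.pdtx 2).pdtx 2).slice z)
    have s₁ := D.energySpace.sob_sub_le (2 * k) (((hu.pdtx 0).pdtx 0).slice z)
      (((hu.pdtx 1).pdtx 1).slice z)
    linarith [hder 0, hder 1, hder 2, hder 3]

end Waveguide

/-- elliptic regularity on the waveguide, even order: let `Ω ⊂ ℝ^d` be a
nonempty bounded domain with smooth boundary.  For every even integer `N ≥ 2` there is a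
constant `C` such that for every `u ∈ C^∞(ℝ₊×ℝ³×Ω̄)` satisfying the Dirichlet or Neumann
boundary condition and every `(t,x)`,
`Σ_{|α|≤N} ‖∂_y^α u(t,x,·)‖_{L²(Ω)} ≤ C Σ_{|α|≤N} ‖∂_{t,x}^α u(t,x,·)‖_{L²(Ω)}
  + C Σ_{|α|≤N-2} ‖∂_{t,x,y}^α □u(t,x,·)‖_{L²(Ω)}`. -/
theorem stmt13 (d : ℕ) (D : SmoothDomain d) (N : ℕ) (hN : 2 ≤ N) (hNeven : Even N) :
    ∃ C : ℝ, 0 < C ∧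
      ∀ u : (Fin 4 → ℝ) → (Fin d → ℝ) → ℝ, SmoothC u →
        (DirichletBC D u ∨ NeumannBC D u) →
        ∀ z : Fin 4 → ℝ, 0 ≤ z 0 →
          (∑ n ∈ Finset.range (N + 1), ∑ σ : Fin n → Fin d,
              L2y D (opIter pdy (List.ofFn σ) u) z) ≤
            C * (∑ n ∈ Finset.range (N + 1), ∑ σ : Fin n → Fin 4,
                L2y D (opIter pdtx (List.ofFn σ) u) z) +
            C * (∑ n ∈ Finset.range (N - 1), ∑ σ : Fin n → (Fin 4 ⊕ Fin d),
                L2y D (opIter pdmix (List.ofFn σ) (wBox u)) z) := by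
  obtain ⟨k, rfl⟩ := hNeven.two_dvd
  obtain ⟨C, hC, h⟩ := D.exists_wordSum_pdy_le k
  refine ⟨C + 1, by linarith, fun u hu hbc z _ => (h u hu hbc z).trans ?_⟩
  rw [← mul_add]
  exact mul_le_mul_of_nonneg_right (by linarith)
    (add_nonneg (wordSum_nonneg (fun u => L2y_nonneg u z) _ _)
      (wordSum_nonneg (fun u => L2y_nonneg u z) _ _))
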